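/- arXiv:1708.07115 — 5 statements merged into one kernel-verified Lean document; each statement's English description precedes it below -/
import Mathlib

section
/- For every integer n ≥ 1, define the Vandermonde determinant V(x) = ∏_{1 ≤ i < j ≤ n} (x_i − x_j) for x = (x_1,…,x_n) ∈ ℂ^n. Then for every θ ∈ ℂ and every x ∈ ℂ^n, ∑_{i=1}^{n} V(x + θ e_i) = n · V(x), where e_i denotes the i-th standard basis vector of ℂ^n (so x + θ e_i adds θ to the i-th coordinate only). -/
namespace Matrix

variable {R : Type*} [CommRing R]

theorem sum_det_updateRow_mul {m : Type*} [Fintype m] [DecidableEq m] (A B : Matrix m m R) :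
    ∑ i, (A.updateRow i ((A * B) i)).det = B.trace * A.det := by
  have h (i : m) : (A.updateRow i ((A * B) i)).det = (A * B * A.adjugate) i i := by
    rw [← cramer_transpose_apply, cramer_eq_adjugate_mulVec, ← adjugate_transpose, mulVec_transpose,
      ← mul_apply_eq_vecMul]
  calc
    _ = (A * B * A.adjugate).trace := Finset.sum_congr rfl fun i _ => h i
    _ = B.trace * A.det := by
      rw [trace_mul_comm, ← Matrix.mul_assoc, adjugate_mul, smul_mul, Matrix.one_mul, trace_smul,
        smul_eq_mul, mul_comm]

theorem vandermonde_update {n : ℕ} (v : Fin n → R) (i : Fin n) (a : R) :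
    vandermonde (Function.update v i a) = (vandermonde v).updateRow i fun j => a ^ (j : ℕ) := by
  ext k j
  obtain rfl | hk := eq_or_ne k i <;> simp [vandermonde_apply, *]

theorem vandermonde_mul_binomial {n : ℕ} (v : Fin n → R) (t : R) (i : Fin n) :
    (vandermonde v * of fun k j : Fin n => t ^ ((j : ℕ) - k) * ((j : ℕ).choose k : R)) i =
      fun j : Fin n => (v i + t) ^ (j : ℕ) := by
  ext j
  simp only [mul_apply, vandermonde_apply, of_apply]
  rw [Fin.sum_univ_eq_sum_range
    (fun k => v i ^ k * (t ^ ((j : ℕ) - k) * ((j : ℕ).choose k : R))) n, add_pow]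
  symm
  simp only [mul_assoc]
  refine Finset.sum_subset (Finset.range_subset_range.2 j.isLt) fun k _ hk => ?_
  rw [Nat.choose_eq_zero_of_lt (by simpa [Nat.succ_le_iff] using hk)]
  simp

theorem sum_det_vandermonde_update_add {n : ℕ} (v : Fin n → R) (t : R) :
    ∑ i, (vandermonde (Function.update v i (v i + t))).det = n * (vandermonde v).det := by
  simp_rw [vandermonde_update, ← vandermonde_mul_binomial]
  rw [sum_det_updateRow_mul]
  simp [trace]

end Matrix


/-- Lemma underlying Lemma 3.4: for the Vandermonde determinant
`V x = ∏_{i < j} (x i − x j)` on `ℂ^n`, one has `∑ i, V (x + θ eᵢ) = n * V x`. -/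
theorem stmt1 (n : ℕ) (hn : 1 ≤ n) (θ : ℂ) (x : Fin n → ℂ)
    (V : (Fin n → ℂ) → ℂ)
    (hV : ∀ y : Fin n → ℂ,
      V y = ∏ i : Fin n, ∏ j ∈ Finset.univ.filter (fun j => i < j), (y i - y j)) :
    ∑ i : Fin n, V (Function.update x i (x i + θ)) = n * V x := by
  have h (y : Fin n → ℂ) : V y = (Matrix.vandermonde (-y)).det := by
    rw [hV, Matrix.det_vandermonde]
    refine Finset.prod_congr rfl fun i _ => Finset.prod_congr (by ext; simp) fun j _ => ?_
    simp only [Pi.neg_apply]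
    ring
  simp only [h]
  rw [← Matrix.sum_det_vandermonde_update_add (-x) (-θ)]
  refine Finset.sum_congr rfl fun i _ => congrArg (fun v => (Matrix.vandermonde v).det) ?_
  ext k
  obtain rfl | hk := eq_or_ne k i
  · simp [add_comm]
  · simp [hk]
end

section
/- Let μ be a probability measure on ℝ that is absolutely continuous with respect to Lebesgue measure with Radon–Nikodym density bounded by 1 almost everywhere. Then there exists a probability measure ν on ℝ such that for every z ∈ ℂ ∖ ℝ, m_ν(z) = 1 − exp(−m_μ(z)). -/
open MeasureTheory
open Filter Topology

lemma norm_ofReal_sub_inv_le {z : ℂ} (hz : z.im ≠ 0) (x : ℝ) :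
    ‖((x : ℂ) - z)⁻¹‖ ≤ |z.im|⁻¹ := by
  rw [norm_inv]
  refine inv_anti₀ (abs_pos.mpr hz) ?_
  simpa using Complex.abs_im_le_norm ((x : ℂ) - z)

lemma ofReal_sub_ne_zero {z : ℂ} (hz : z.im ≠ 0) (x : ℝ) : (x : ℂ) - z ≠ 0 := by
  intro h
  exact hz (by simpa using congrArg Complex.im h)

lemma continuous_ofReal_sub_inv {z : ℂ} (hz : z.im ≠ 0) :
    Continuous fun x : ℝ ↦ ((x : ℂ) - z)⁻¹ :=
  (Complex.continuous_ofReal.sub continuous_const).inv₀ (ofReal_sub_ne_zero hz)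

lemma norm_ofReal_sub_inv_sub_le {z : ℂ} (hz : z.im ≠ 0) (x y : ℝ) :
    ‖((x : ℂ) - z)⁻¹ - ((y : ℂ) - z)⁻¹‖ ≤ |z.im|⁻¹ ^ 2 * |x - y| := by
  have hx := ofReal_sub_ne_zero hz x
  have hy := ofReal_sub_ne_zero hz y
  have h : ((x : ℂ) - z)⁻¹ - ((y : ℂ) - z)⁻¹
      = ((x : ℂ) - z)⁻¹ * ((y : ℂ) - z)⁻¹ * ((y - x : ℝ) : ℂ) := by
    field_simp
    push_cast
    ring
  rw [h, norm_mul, norm_mul, Complex.norm_real, Real.norm_eq_abs, abs_sub_comm y x, pow_two]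
  gcongr <;> exact norm_ofReal_sub_inv_le hz _

lemma integrable_ofReal_sub_inv (μ : Measure ℝ) [IsFiniteMeasure μ] {z : ℂ} (hz : z.im ≠ 0) :
    Integrable (fun x : ℝ ↦ ((x : ℂ) - z)⁻¹) μ :=
  .of_bound (continuous_ofReal_sub_inv hz).aestronglyMeasurable _
    (.of_forall (norm_ofReal_sub_inv_le hz))

/-- The transform of Lebesgue measure on an interval exponentiates to a Möbius factor. -/
lemma exp_neg_intervalIntegral_ofReal_sub_inv {z : ℂ} (hz : z.im ≠ 0) (a b : ℝ) :
    Complex.exp (-∫ x in a..b, ((x : ℂ) - z)⁻¹) = ((a : ℂ) - z) / ((b : ℂ) - z) := by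
  have hderiv (x : ℝ) : HasDerivAt (fun t : ℝ ↦ Complex.log ((t : ℂ) - z)) ((x : ℂ) - z)⁻¹ x := by
    have h1 : HasDerivAt (fun t : ℝ ↦ (t : ℂ) - z) 1 x :=
      (Complex.ofRealCLM.hasDerivAt (x := x)).sub_const z
    have h2 : (x : ℂ) - z ∈ Complex.slitPlane := by
      rw [Complex.mem_slitPlane_iff]
      right
      simpa using hz
    simpa using h1.clog_real h2
  rw [intervalIntegral.integral_eq_sub_of_hasDerivAt (fun x _ ↦ hderiv x)
    ((continuous_ofReal_sub_inv hz).intervalIntegrable _ _), neg_sub, Complex.exp_sub,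
    Complex.exp_log (ofReal_sub_ne_zero hz a), Complex.exp_log (ofReal_sub_ne_zero hz b)]

/-- A product of Möbius factors with interlacing zeros and poles has a partial fraction
decomposition with coefficients of constant sign. -/
lemma exists_partialFraction_of_interlacing {a b : ℕ → ℝ} (hab : ∀ k, a k ≤ b k)
    (hba : ∀ k, b k ≤ a (k + 1)) (m : ℕ) :
    ∃ w : ℕ → ℝ, (∀ k, 0 ≤ w k) ∧
      ∑ k ∈ Finset.range m, w k = ∑ k ∈ Finset.range m, (b k - a k) ∧
      ∀ z : ℂ, z.im ≠ 0 →
        ∏ k ∈ Finset.range m, ((a k : ℂ) - z) / ((b k : ℂ) - z)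
          = 1 - ∑ k ∈ Finset.range m, (w k : ℂ) * ((b k : ℂ) - z)⁻¹ := by
  induction m with
  | zero => exact ⟨0, by simp, by simp, by simp⟩
  | succ m ih =>
    obtain ⟨w, hw0, hws, hwz⟩ := ih
    have hmono : Monotone b := monotone_nat_of_le_succ fun k ↦ (hba k).trans (hab _)
    have hbm {k : ℕ} (hk : k < m) : b k ≤ a m := by
      obtain ⟨j, rfl⟩ : ∃ j, m = j + 1 := ⟨m - 1, by omega⟩
      exact (hmono (by omega)).trans (hba j)
    set δ := b m - a m with hδ
    have hδ0 : 0 ≤ δ := sub_nonneg.mpr (hab m)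
    let c : ℕ → ℝ := fun k ↦ w k * (δ / (b m - b k))
    let w' : ℕ → ℝ := fun k ↦ if k < m then w k - c k else
      if k = m then δ + ∑ j ∈ Finset.range m, c j else 0
    have hw'lt {k : ℕ} (hk : k ∈ Finset.range m) : w' k = w k - c k := by
      simp [w', Finset.mem_range.mp hk]
    have hw'm : w' m = δ + ∑ j ∈ Finset.range m, c j := by simp [w']
    have hc0 (k : ℕ) (hk : k < m) : 0 ≤ c k := by
      have := hbm hk
      have := hab m
      exact mul_nonneg (hw0 k) (div_nonneg hδ0 (by linarith))
    have hm0 : 0 ≤ w' m := by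
      rw [hw'm]
      exact add_nonneg hδ0 (Finset.sum_nonneg fun j hj ↦ hc0 j (Finset.mem_range.mp hj))
    refine ⟨w', fun k ↦ ?_, ?_, fun z hz ↦ ?_⟩
    · rcases lt_trichotomy k m with hk | rfl | hk
      · rw [hw'lt (Finset.mem_range.mpr hk)]
        have h1 := hbm hk
        have h2 := hab m
        have h3 : δ / (b m - b k) ≤ 1 := div_le_one_of_le₀ (by linarith) (by linarith)
        have h4 := mul_le_mul_of_nonneg_left h3 (hw0 k)
        simp only [c]
        linarith
      · exact hm0
      · simp [w', hk.not_gt, hk.ne']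
    · rw [Finset.sum_range_succ, Finset.sum_range_succ, hw'm,
        Finset.sum_congr rfl fun k hk ↦ hw'lt hk,
        Finset.sum_sub_distrib, ← hws]
      ring
    · have hbz := ofReal_sub_ne_zero hz (b m)
      have hfac : ((a m : ℂ) - z) / ((b m : ℂ) - z) = 1 - δ * ((b m : ℂ) - z)⁻¹ := by
        simp only [hδ]
        field_simp
        push_cast
        ring
      have hterm (k : ℕ) (hk : k ∈ Finset.range m) :
          (w k : ℂ) * ((b k : ℂ) - z)⁻¹ * (δ * ((b m : ℂ) - z)⁻¹)
            = c k * ((b k : ℂ) - z)⁻¹ - c k * ((b m : ℂ) - z)⁻¹ := by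
        have hbk := ofReal_sub_ne_zero hz (b k)
        rcases eq_or_ne (b m) (b k) with h | h
        · have h1 := hbm (Finset.mem_range.mp hk)
          have h2 := hab m
          have : δ = 0 := by linarith
          simp [c, this]
        · have h' : (b m : ℂ) - b k ≠ 0 := by
            rw [sub_ne_zero]
            exact_mod_cast h
          simp only [c]
          push_cast
          field_simp
          ring
      rw [Finset.prod_range_succ, hwz z hz, hfac, Finset.sum_range_succ, hw'm,
        Finset.sum_congr rfl fun k hk ↦
          congrArg (fun t : ℝ ↦ (t : ℂ) * ((b k : ℂ) - z)⁻¹) (hw'lt hk)]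
      have hsum := Finset.sum_congr rfl hterm
      rw [← Finset.sum_mul, Finset.sum_sub_distrib, ← Finset.sum_mul] at hsum
      push_cast
      simp only [sub_mul, Finset.sum_sub_distrib]
      linear_combination hsum

/-- Tail bound for a probability measure in terms of its Stieltjes transform on the imaginary
axis. -/
lemma measureReal_norm_gt_le_stieltjes (ν : Measure ℝ) [IsProbabilityMeasure ν] {r : ℝ}
    (hr : 0 < r) :
    ν.real {x | r < ‖x‖} ≤
      2 * (1 + (r * Complex.I * ∫ x : ℝ, ((x : ℂ) - r * Complex.I)⁻¹ ∂ν).re) := by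
  have him : (r * Complex.I).im ≠ 0 := by simpa using hr.ne'
  have hint := (integrable_ofReal_sub_inv ν him).const_mul (r * Complex.I)
  have hpt (x : ℝ) : 1 + (r * Complex.I * ((x : ℂ) - r * Complex.I)⁻¹).re
      = x ^ 2 / (x ^ 2 + r ^ 2) := by
    have : x ^ 2 + r ^ 2 ≠ 0 := by positivity
    simp [Complex.inv_re, Complex.inv_im, Complex.normSq_apply]
    field_simp
    ring
  have hre : 1 + (r * Complex.I * ∫ x : ℝ, ((x : ℂ) - r * Complex.I)⁻¹ ∂ν).re
      = ∫ x : ℝ, x ^ 2 / (x ^ 2 + r ^ 2) ∂ν := by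
    simp_rw [← hpt]
    rw [integral_add (g := fun x : ℝ ↦ (r * Complex.I * ((x : ℂ) - r * Complex.I)⁻¹).re)
      (integrable_const _) hint.re, ← integral_const_mul]
    congr 1
    · simp
    · exact (integral_re hint).symm
  have hint' : Integrable (fun x : ℝ ↦ x ^ 2 / (x ^ 2 + r ^ 2)) ν := by
    simp_rw [← hpt]
    exact (integrable_const _).add hint.re
  have hmarkov := mul_meas_ge_le_integral_of_nonneg (μ := ν)
    (.of_forall fun x : ℝ ↦ by positivity) hint' (1 / 2)
  have hsub : ν.real {x | r < ‖x‖} ≤ ν.real {x : ℝ | 1 / 2 ≤ x ^ 2 / (x ^ 2 + r ^ 2)} := by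
    refine measureReal_mono fun x hx ↦ ?_
    have hx' : r < |x| := hx
    have : r ^ 2 ≤ x ^ 2 := by
      rw [← sq_abs x]
      gcongr
    rw [Set.mem_ofPred_eq, div_le_div_iff₀ (by norm_num) (by positivity)]
    linarith
  rw [hre]
  linarith

/-- Continuity theorem for the Stieltjes transform. -/
lemma exists_isProbabilityMeasure_of_tendsto_stieltjes {ν : ℕ → Measure ℝ}
    [∀ n, IsProbabilityMeasure (ν n)] {G : ℂ → ℂ}
    (hG : ∀ z : ℂ, z.im ≠ 0 →
      Tendsto (fun n ↦ ∫ x : ℝ, ((x : ℂ) - z)⁻¹ ∂(ν n)) atTop (𝓝 (G z)))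
    (hinf : Tendsto (fun y : ℝ ↦ y * Complex.I * G (y * Complex.I)) atTop (𝓝 (-1))) :
    ∃ ν₀ : Measure ℝ, IsProbabilityMeasure ν₀ ∧
      ∀ z : ℂ, z.im ≠ 0 → ∫ x : ℝ, ((x : ℂ) - z)⁻¹ ∂ν₀ = G z := by
  have htight : IsTightMeasureSet (Set.range ν) := by
    refine isTightMeasureSet_range_of_tendsto_limsup_measure_norm_gt ?_
    have hlim : Tendsto
        (fun r : ℝ ↦ ENNReal.ofReal (2 * (1 + (r * Complex.I * G (r * Complex.I)).re)))
        atTop (𝓝 0) := by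
      have h := (Complex.continuous_re.tendsto _).comp hinf
      have h' := ENNReal.tendsto_ofReal ((h.const_add 1).const_mul 2)
      simpa using h'
    refine tendsto_of_tendsto_of_tendsto_of_le_of_le' tendsto_const_nhds hlim
      (.of_forall fun _ ↦ zero_le) ?_
    filter_upwards [eventually_gt_atTop 0] with r hr
    have him : (r * Complex.I).im ≠ 0 := by simpa using hr.ne'
    have h := ENNReal.tendsto_ofReal ((((Complex.continuous_re.tendsto _).comp
      ((hG _ him).const_mul (r * Complex.I))).const_add 1).const_mul 2)
    rw [← h.limsup_eq]
    refine limsup_le_limsup (.of_forall fun n ↦ ?_)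
    change ν n {x | r < ‖x‖} ≤ _
    rw [← ofReal_measureReal]
    exact ENNReal.ofReal_le_ofReal (measureReal_norm_gt_le_stieltjes (ν n) hr)
  let P : ℕ → ProbabilityMeasure ℝ := fun n ↦ ⟨ν n, inferInstance⟩
  have hcomp : IsCompact (closure (Set.range P)) := by
    refine isCompact_closure_of_isTightMeasureSet (htight.subset ?_)
    rintro _ ⟨_, ⟨n, rfl⟩, rfl⟩
    exact ⟨n, rfl⟩
  obtain ⟨P₀, -, hP₀⟩ := hcomp.ultrafilter_le_nhds' ((hyperfilter ℕ).map P)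
    (Ultrafilter.mem_map.mpr (univ_mem' fun n ↦ subset_closure ⟨n, rfl⟩))
  refine ⟨P₀, inferInstance, fun z hz ↦ ?_⟩
  have hT : Tendsto P (hyperfilter ℕ) (𝓝 P₀) := hP₀
  rw [ProbabilityMeasure.tendsto_iff_forall_integral_rclike_tendsto ℂ] at hT
  refine tendsto_nhds_unique (hT (BoundedContinuousFunction.ofNormedAddCommGroup _
    (continuous_ofReal_sub_inv hz) _ (norm_ofReal_sub_inv_le hz))) ?_
  exact (hG z hz).mono_left Nat.hyperfilter_le_atTop

lemma norm_mul_I_mul_inv_le (x y : ℝ) :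
    ‖(y * Complex.I) * ((x : ℂ) - y * Complex.I)⁻¹‖ ≤ 1 := by
  rw [norm_mul, norm_inv, ← div_eq_mul_inv]
  refine div_le_one_of_le₀ ?_ (norm_nonneg _)
  simpa using Complex.abs_im_le_norm ((x : ℂ) - y * Complex.I)

lemma tendsto_stieltjes_atTop (μ : Measure ℝ) [IsProbabilityMeasure μ] :
    Tendsto (fun y : ℝ ↦ y * Complex.I * ∫ x : ℝ, ((x : ℂ) - y * Complex.I)⁻¹ ∂μ)
      atTop (𝓝 (-1)) := by
  simp_rw [← integral_const_mul]
  have h1 : (-1 : ℂ) = ∫ _ : ℝ, (-1 : ℂ) ∂μ := by simp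
  rw [h1]
  refine tendsto_integral_filter_of_dominated_convergence (fun _ ↦ 1) ?_
    (.of_forall fun y ↦ .of_forall fun x ↦ norm_mul_I_mul_inv_le x y) (integrable_const _)
    (.of_forall fun x ↦ ?_)
  · exact .of_forall fun y ↦ by fun_prop
  · have hlim : Tendsto (fun y : ℝ ↦ Complex.I * ((x : ℂ) * ((y⁻¹ : ℝ) : ℂ) - Complex.I)⁻¹) atTop
        (𝓝 (Complex.I * ((x : ℂ) * ((0 : ℝ) : ℂ) - Complex.I)⁻¹)) := by
      have := (Complex.continuous_ofReal.tendsto 0).comp tendsto_inv_atTop_zero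
      exact (((this.const_mul _).sub_const _).inv₀ (by simp)).const_mul _
    have hval : Complex.I * ((x : ℂ) * ((0 : ℝ) : ℂ) - Complex.I)⁻¹ = -1 := by
      simp
    rw [hval] at hlim
    refine hlim.congr' ?_
    filter_upwards [eventually_gt_atTop 0] with y hy
    have hy' : (y : ℂ) ≠ 0 := by exact_mod_cast hy.ne'
    have : (x : ℂ) * ((y⁻¹ : ℝ) : ℂ) - Complex.I = (y : ℂ)⁻¹ * (x - y * Complex.I) := by
      push_cast
      field_simp
    rw [this, mul_inv, inv_inv]
    ring

lemma tendsto_one_sub_exp_neg_stieltjes_atTop (μ : Measure ℝ) [IsProbabilityMeasure μ] :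
    Tendsto (fun y : ℝ ↦ y * Complex.I *
      (1 - Complex.exp (-∫ x : ℝ, ((x : ℂ) - y * Complex.I)⁻¹ ∂μ))) atTop (𝓝 (-1)) := by
  have hm := tendsto_stieltjes_atTop μ
  set M : ℝ → ℂ := fun y ↦ ∫ x : ℝ, ((x : ℂ) - y * Complex.I)⁻¹ ∂μ with hM
  have hM0 : Tendsto M atTop (𝓝 0) := by
    refine squeeze_zero_norm' (a := fun y ↦ y⁻¹) ?_ tendsto_inv_atTop_zero
    filter_upwards [eventually_gt_atTop 0] with y hy
    have him : (y * Complex.I).im ≠ 0 := by simpa using hy.ne'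
    have := norm_integral_le_of_norm_le_const (μ := μ)
      (.of_forall (norm_ofReal_sub_inv_le him))
    simpa [abs_of_pos hy] using this
  have herr : Tendsto (fun y : ℝ ↦ y * Complex.I * (Complex.exp (-M y) - 1 - -M y)) atTop
      (𝓝 0) := by
    have hb : Tendsto (fun y : ℝ ↦ ‖y * Complex.I * M y‖ * ‖M y‖) atTop (𝓝 0) := by
      simpa using hm.norm.mul hM0.norm
    refine squeeze_zero_norm' ?_ hb
    have hsmall : ∀ᶠ y in atTop, ‖M y‖ < 1 := hM0.norm.eventually_lt_const (by simp)
    filter_upwards [hsmall] with y hy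
    have h := Complex.norm_exp_sub_one_sub_id_le (x := -M y) (by simpa using hy.le)
    rw [norm_neg] at h
    rw [norm_mul, norm_mul (_ * _) (M y), mul_assoc, ← pow_two]
    gcongr
  have h := hm.sub herr
  rw [sub_zero] at h
  refine h.congr fun y ↦ ?_
  simp only [hM]
  ring

lemma measure_le_volume_of_rnDeriv_le_one {μ : Measure ℝ} [SFinite μ] (hac : μ ≪ volume)
    (hd : ∀ᵐ x ∂volume, μ.rnDeriv volume x ≤ 1) : μ ≤ volume := by
  rw [← Measure.withDensity_rnDeriv_eq μ volume hac]
  conv_rhs => rw [← withDensity_one (μ := (volume : Measure ℝ))]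
  exact withDensity_mono hd

/-- Replacing a measure on a short interval by Lebesgue measure on an initial segment of equal
mass changes the integral of a Lipschitz function only slightly. -/
lemma norm_intervalIntegral_sub_le_of_lipschitz {μ : Measure ℝ} [IsFiniteMeasure μ]
    (hμ : μ ≤ volume) {f : ℝ → ℂ} {L : ℝ} (hfc : Continuous f)
    (hL : ∀ x y, ‖f x - f y‖ ≤ L * |x - y|) {a c : ℝ} (hac : a ≤ c) :
    ‖(∫ x in a..(a + μ.real (Set.Ioc a c)), f x) - ∫ x in a..c, f x ∂μ‖
      ≤ 2 * (L * (c - a)) * μ.real (Set.Ioc a c) := by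
  set p := μ.real (Set.Ioc a c) with hp
  have hp0 : 0 ≤ p := measureReal_nonneg
  have hL0 : 0 ≤ L := by simpa using (norm_nonneg _).trans (hL 1 0)
  have hpc : p ≤ c - a := by
    have h := ENNReal.toReal_mono (by simp) (hμ (Set.Ioc a c))
    rwa [Real.volume_Ioc, ENNReal.toReal_ofReal (sub_nonneg.mpr hac)] at h
  have h1 : ‖(∫ x in a..(a + p), f x) - p * f a‖ ≤ L * (c - a) * p := by
    have h := intervalIntegral.norm_integral_le_of_norm_le_const (a := a) (b := a + p)
      (f := fun x ↦ f x - f a) (C := L * (c - a)) fun x hx ↦ by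
        rw [Set.uIoc_of_le (by linarith)] at hx
        refine (hL x a).trans ?_
        rw [abs_of_pos (by linarith [hx.1])]
        gcongr
        linarith [hx.2]
    rw [intervalIntegral.integral_sub (hfc.intervalIntegrable _ _)
      intervalIntegrable_const] at h
    simpa [abs_of_nonneg hp0] using h
  have h2 : ‖(∫ x in a..c, f x ∂μ) - p * f a‖ ≤ L * (c - a) * p := by
    have h := norm_setIntegral_le_of_norm_le_const (μ := μ) (s := Set.Ioc a c)
      (f := fun x ↦ f x - f a) (C := L * (c - a)) (measure_lt_top _ _) fun x hx ↦ by
        refine (hL x a).trans ?_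
        rw [abs_of_pos (by linarith [hx.1])]
        gcongr
        linarith [hx.2]
    rw [← intervalIntegral.integral_of_le hac, intervalIntegral.integral_sub
      (hfc.intervalIntegrable _ _) intervalIntegrable_const,
      intervalIntegral.integral_of_le (f := fun _ ↦ f a) hac, setIntegral_const] at h
    simpa [← hp] using h
  calc _ = ‖((∫ x in a..(a + p), f x) - p * f a) - ((∫ x in a..c, f x ∂μ) - p * f a)‖ := by
        congr 1; ring
    _ ≤ _ := norm_sub_le _ _
    _ ≤ _ := by linarith

/-- A measure dominated by Lebesgue measure is a limit of uniform measures on finite unions of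
intervals with interlacing endpoints. -/
lemma exists_interlacing_tendsto {μ : Measure ℝ} [IsProbabilityMeasure μ] (hμ : μ ≤ volume) :
    ∃ (m : ℕ → ℕ) (a b : ℕ → ℕ → ℝ), (∀ n k, a n k ≤ b n k) ∧ (∀ n k, b n k ≤ a n (k + 1)) ∧
      (∀ n, ∑ k ∈ Finset.range (m n), (b n k - a n k) ≤ 1) ∧
      ∀ (f : ℝ → ℂ) (L : ℝ), Continuous f → Integrable f μ →
        (∀ x y, ‖f x - f y‖ ≤ L * |x - y|) →
        Tendsto (fun n ↦ ∑ k ∈ Finset.range (m n), ∫ x in a n k..b n k, f x) atTop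
          (𝓝 (∫ x, f x ∂μ)) := by
  let m : ℕ → ℕ := fun n ↦ 2 * (n + 1) ^ 2
  let a : ℕ → ℕ → ℝ := fun n k ↦ -((n : ℝ) + 1) + k / ((n : ℝ) + 1)
  have hstep (n k : ℕ) : a n (k + 1) - a n k = 1 / ((n : ℝ) + 1) := by
    simp only [a]
    push_cast
    ring
  have ha (n k : ℕ) : a n k ≤ a n (k + 1) := by
    rw [← sub_nonneg, hstep]
    positivity
  have ha0 (n : ℕ) : a n 0 = -((n : ℝ) + 1) := by simp [a]
  have ham (n : ℕ) : a n (m n) = (n : ℝ) + 1 := by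
    simp only [a, m]
    push_cast
    field_simp
    ring
  let p : ℕ → ℕ → ℝ := fun n k ↦ μ.real (Set.Ioc (a n k) (a n (k + 1)))
  have hp0 (n k : ℕ) : 0 ≤ p n k := measureReal_nonneg
  have hpa (n k : ℕ) : p n k ≤ a n (k + 1) - a n k := by
    have h := ENNReal.toReal_mono (by simp) (hμ (Set.Ioc (a n k) (a n (k + 1))))
    rwa [Real.volume_Ioc, ENNReal.toReal_ofReal (sub_nonneg.mpr (ha n k))] at h
  have hsum (n : ℕ) : ∑ k ∈ Finset.range (m n), p n k ≤ 1 := by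
    have h := intervalIntegral.sum_integral_adjacent_intervals (a := a n) (n := m n) (μ := μ)
      (f := fun _ ↦ (1 : ℝ)) fun k _ ↦ intervalIntegrable_const
    have h' (k : ℕ) : ∫ x in a n k..a n (k + 1), (1 : ℝ) ∂μ = p n k := by
      rw [intervalIntegral.integral_of_le (ha n k)]
      simp [p]
    simp_rw [h'] at h
    rw [h, intervalIntegral.integral_of_le (by rw [ha0, ham]; linarith [n.cast_nonneg (α := ℝ)])]
    simp
  refine ⟨m, a, fun n k ↦ a n k + p n k, fun n k ↦ by linarith [hp0 n k],
    fun n k ↦ by linarith [hpa n k], fun n ↦ by simpa using hsum n, fun f L hfc hfi hL ↦ ?_⟩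
  have hL0 : 0 ≤ L := by simpa using (norm_nonneg _).trans (hL 1 0)
  have htop : Tendsto (fun n : ℕ ↦ (n : ℝ) + 1) atTop atTop :=
    tendsto_atTop_add_const_right _ _ tendsto_natCast_atTop_atTop
  have hmain : Tendsto (fun n : ℕ ↦ ∫ x in a n 0..a n (m n), f x ∂μ) atTop
      (𝓝 (∫ x, f x ∂μ)) := by
    simp_rw [ha0, ham]
    exact intervalIntegral_tendsto_integral hfi (tendsto_neg_atTop_atBot.comp htop) htop
  have herr : Tendsto (fun n ↦ (∑ k ∈ Finset.range (m n), ∫ x in a n k..(a n k + p n k), f x)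
      - ∫ x in a n 0..a n (m n), f x ∂μ) atTop (𝓝 0) := by
    have hb : Tendsto (fun n : ℕ ↦ 2 * (L * (1 / ((n : ℝ) + 1)))) atTop (𝓝 0) := by
      simpa using (tendsto_one_div_add_atTop_nhds_zero_nat.const_mul L).const_mul 2
    refine squeeze_zero_norm (fun n ↦ ?_) hb
    rw [← intervalIntegral.sum_integral_adjacent_intervals fun k _ ↦ hfi.intervalIntegrable,
      ← Finset.sum_sub_distrib]
    calc _ ≤ ∑ k ∈ Finset.range (m n), 2 * (L * (1 / ((n : ℝ) + 1))) * p n k := by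
          refine norm_sum_le_of_le _ fun k _ ↦ ?_
          rw [← hstep n k]
          exact norm_intervalIntegral_sub_le_of_lipschitz hμ hfc hL (ha n k)
      _ = 2 * (L * (1 / ((n : ℝ) + 1))) * ∑ k ∈ Finset.range (m n), p n k := by
          rw [Finset.mul_sum]
      _ ≤ 2 * (L * (1 / ((n : ℝ) + 1))) * 1 := by
          gcongr
          exact hsum n
      _ = _ := mul_one _
  simpa using herr.add hmain

/-- A finite convex combination of point masses, completed by a mass at the origin, realises a
given sum of simple fractions. -/
lemma exists_isProbabilityMeasure_sum_dirac {w : ℕ → ℝ} (hw : ∀ k, 0 ≤ w k) (b : ℕ → ℝ) (m : ℕ)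
    (hs : ∑ k ∈ Finset.range m, w k ≤ 1) :
    ∃ ν : Measure ℝ, IsProbabilityMeasure ν ∧ ∀ f : ℝ → ℂ,
      ∫ x, f x ∂ν = ∑ k ∈ Finset.range m, (w k : ℂ) * f (b k)
        + ((1 - ∑ k ∈ Finset.range m, w k : ℝ) : ℂ) * f 0 := by
  have hs0 : 0 ≤ 1 - ∑ k ∈ Finset.range m, w k := sub_nonneg.mpr hs
  refine ⟨∑ k ∈ Finset.range m, ENNReal.ofReal (w k) • Measure.dirac (b k)
    + ENNReal.ofReal (1 - ∑ k ∈ Finset.range m, w k) • Measure.dirac 0, ⟨?_⟩, fun f ↦ ?_⟩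
  · simp only [Measure.coe_add, Measure.coe_finsetSum, Measure.coe_smul, Pi.add_apply,
      Finset.sum_apply, Pi.smul_apply, measure_univ, smul_eq_mul, mul_one]
    rw [← ENNReal.ofReal_sum_of_nonneg fun k _ ↦ hw k,
      ← ENNReal.ofReal_add (Finset.sum_nonneg fun k _ ↦ hw k) hs0]
    simp
  · have hi (c x : ℝ) : Integrable f (ENNReal.ofReal c • Measure.dirac x) :=
      (integrable_dirac (by simp)).smul_measure (by simp)
    rw [integral_add_measure (integrable_finsetSum_measure.mpr fun k _ ↦ hi _ _) (hi _ _),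
      integral_finsetSum_measure fun k _ ↦ hi _ _]
    simp [ENNReal.toReal_ofReal, hw, hs0, -Complex.ofReal_sub]

/-- Markov–Krein correspondence (existence part, Theorem 2.2): if `μ` is a probability
measure on `ℝ`, absolutely continuous with density at most `1`, then there is a probability
measure `ν` on `ℝ` whose Stieltjes transform satisfies `m_ν(z) = 1 − exp(−m_μ(z))` for all
`z ∈ ℂ ∖ ℝ`. -/
theorem stmt3 (μ : Measure ℝ) [IsProbabilityMeasure μ]
    (hac : μ ≪ volume)
    (hd : ∀ᵐ x ∂volume, μ.rnDeriv volume x ≤ 1) :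
    ∃ ν : Measure ℝ, IsProbabilityMeasure ν ∧
      ∀ z : ℂ, z.im ≠ 0 →
        (∫ x : ℝ, ((x : ℂ) - z)⁻¹ ∂ν)
          = 1 - Complex.exp (-(∫ x : ℝ, ((x : ℂ) - z)⁻¹ ∂μ)) := by
  obtain ⟨m, a, b, hab, hba, hle, hlim⟩ :=
    exists_interlacing_tendsto (measure_le_volume_of_rnDeriv_le_one hac hd)
  choose w hw0 hws hwz using fun n ↦ exists_partialFraction_of_interlacing (hab n) (hba n) (m n)
  choose ν hν hνf using fun n ↦
    exists_isProbabilityMeasure_sum_dirac (hw0 n) (b n) (m n) ((hws n).trans_le (hle n))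
  have hmass : Tendsto (fun n ↦ ((1 - ∑ k ∈ Finset.range (m n), w n k : ℝ) : ℂ)) atTop
      (𝓝 0) := by
    have h := hlim (fun _ ↦ 1) 0 continuous_const (integrable_const _) (by simp)
    have h' := h.const_sub 1
    simp only [integral_const, probReal_univ, one_smul, sub_self] at h'
    refine h'.congr fun n ↦ ?_
    rw [hws n]
    simp
  refine exists_isProbabilityMeasure_of_tendsto_stieltjes (ν := ν)
    (G := fun z ↦ 1 - Complex.exp (-∫ x : ℝ, ((x : ℂ) - z)⁻¹ ∂μ)) (fun z hz ↦ ?_)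
    (tendsto_one_sub_exp_neg_stieltjes_atTop μ)
  have h1 := hlim _ _ (continuous_ofReal_sub_inv hz) (integrable_ofReal_sub_inv μ hz)
    (norm_ofReal_sub_inv_sub_le hz)
  have h2 := ((Complex.continuous_exp.tendsto _).comp h1.neg).const_sub 1
  have h3 := h2.add (hmass.mul_const (((0 : ℝ) : ℂ) - z)⁻¹)
  rw [zero_mul, add_zero] at h3
  refine h3.congr fun n ↦ ?_
  rw [hνf n, Function.comp_apply, ← Finset.sum_neg_distrib, Complex.exp_sum,
    Finset.prod_congr rfl fun k _ ↦ exp_neg_intervalIntegral_ofReal_sub_inv hz _ _, hwz n z hz,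
    sub_sub_cancel]
end

section
/- Fix T > 0 and a probability measure μ_0 on ℝ that is absolutely continuous with density at most 1, with Stieltjes transform m_0. Suppose {μ_t}_{0 ≤ t ≤ T} and {ν_t}_{0 ≤ t ≤ T} are two families of probability measures on ℝ, each absolutely continuous with density at most 1, with μ_0 = ν_0, such that for each z ∈ ℂ ∖ ℝ the maps t ↦ m_{μ_t}(z) and t ↦ m_{ν_t}(z) are continuous and satisfy, for all t ∈ [0,T] and z ∈ ℂ ∖ ℝ, m_{μ_t}(z) = m_0(z) − ∫_0^t e^{−m_{μ_s}(z)} · ∂_z m_{μ_s}(z) ds and m_{ν_t}(z) = m_0(z) − ∫_0^t e^{−m_{ν_s}(z)} · ∂_z m_{ν_s}(z) ds. Then μ_t = ν_t for all t ∈ [0,T]. -/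
open MeasureTheory

namespace StieltjesBurgers

open Set Filter Topology Complex FourierTransform

lemma sub_ne_zero_of_le_im {η : ℝ} (hη : 0 < η) {z : ℂ} (hz : η ≤ z.im) (x : ℝ) :
    (x : ℂ) - z ≠ 0 := by
  intro h
  have := congrArg Complex.im h
  simp at this
  linarith

lemma norm_inv_ofReal_sub_le {η : ℝ} (hη : 0 < η) {z : ℂ} (hz : η ≤ z.im) (x : ℝ) :
    ‖((x : ℂ) - z)⁻¹‖ ≤ η⁻¹ := by
  rw [norm_inv]
  refine inv_anti₀ hη (hz.trans ?_)
  have := (le_abs_self _).trans (Complex.abs_im_le_norm (z - x))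
  rw [norm_sub_rev]
  simpa using this

lemma integrable_inv_pow (P : Measure ℝ) [IsProbabilityMeasure P] {η : ℝ} (hη : 0 < η) {z : ℂ}
    (hz : η ≤ z.im) (n : ℕ) : Integrable (fun x : ℝ => ((x : ℂ) - z)⁻¹ ^ n) P := by
  refine Integrable.of_bound (Measurable.aestronglyMeasurable (by fun_prop)) (η⁻¹ ^ n)
    (.of_forall fun x => ?_)
  rw [norm_pow]
  exact pow_le_pow_left₀ (norm_nonneg _) (norm_inv_ofReal_sub_le hη hz x) n

lemma norm_integral_inv_pow_le (P : Measure ℝ) [IsProbabilityMeasure P] {η : ℝ} (hη : 0 < η) {z : ℂ}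
    (hz : η ≤ z.im) (n : ℕ) : ‖∫ x : ℝ, ((x : ℂ) - z)⁻¹ ^ n ∂P‖ ≤ η⁻¹ ^ n := by
  refine (norm_integral_le_of_norm_le_const (C := η⁻¹ ^ n) (.of_forall fun x => ?_)).trans (by simp)
  rw [norm_pow]
  exact pow_le_pow_left₀ (norm_nonneg _) (norm_inv_ofReal_sub_le hη hz x) n

lemma norm_stieltjes_le (P : Measure ℝ) [IsProbabilityMeasure P] {η : ℝ} (hη : 0 < η) {z : ℂ}
    (hz : η ≤ z.im) : ‖∫ x : ℝ, ((x : ℂ) - z)⁻¹ ∂P‖ ≤ η⁻¹ := by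
  simpa using norm_integral_inv_pow_le P hη hz 1

lemma norm_stieltjes_sub_le (P : Measure ℝ) [IsProbabilityMeasure P] {η : ℝ} (hη : 0 < η)
    {z w : ℂ} (hz : η ≤ z.im) (hw : η ≤ w.im) :
    ‖(∫ x : ℝ, ((x : ℂ) - w)⁻¹ ∂P) - ∫ x : ℝ, ((x : ℂ) - z)⁻¹ ∂P‖ ≤ ‖w - z‖ * η⁻¹ ^ 2 := by
  have hi := fun {z : ℂ} (hz : η ≤ z.im) => by simpa using integrable_inv_pow P hη hz 1
  rw [← integral_sub (hi hw) (hi hz)]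
  refine (norm_integral_le_of_norm_le_const (C := ‖w - z‖ * η⁻¹ ^ 2)
    (.of_forall fun x => ?_)).trans (by simp)
  have h1 := sub_ne_zero_of_le_im hη hz x
  have h2 := sub_ne_zero_of_le_im hη hw x
  have : ((x : ℂ) - w)⁻¹ - ((x : ℂ) - z)⁻¹ = (w - z) * (((x : ℂ) - w)⁻¹ * ((x : ℂ) - z)⁻¹) := by
    field_simp
    ring
  rw [this, norm_mul, norm_mul, sq]
  gcongr <;> exact norm_inv_ofReal_sub_le hη ‹_› x

lemma norm_stieltjes_taylor_le (P : Measure ℝ) [IsProbabilityMeasure P] {η : ℝ} (hη : 0 < η)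
    {z w : ℂ} (hz : η ≤ z.im) (hw : η ≤ w.im) :
    ‖(∫ x : ℝ, ((x : ℂ) - w)⁻¹ ∂P) - (∫ x : ℝ, ((x : ℂ) - z)⁻¹ ∂P)
      - (w - z) * ∫ x : ℝ, ((x : ℂ) - z)⁻¹ ^ 2 ∂P‖ ≤ ‖w - z‖ ^ 2 * η⁻¹ ^ 3 := by
  have hi := fun {z : ℂ} (hz : η ≤ z.im) => by simpa using integrable_inv_pow P hη hz 1
  rw [← integral_sub (hi hw) (hi hz), ← integral_const_mul,
    ← integral_sub (f := fun x : ℝ => ((x : ℂ) - w)⁻¹ - ((x : ℂ) - z)⁻¹)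
    ((hi hw).sub (hi hz))
    ((integrable_inv_pow P hη hz 2).const_mul _)]
  refine (norm_integral_le_of_norm_le_const (C := ‖w - z‖ ^ 2 * η⁻¹ ^ 3)
    (.of_forall fun x => ?_)).trans (by simp)
  have h1 := sub_ne_zero_of_le_im hη hz x
  have h2 := sub_ne_zero_of_le_im hη hw x
  have : ((x : ℂ) - w)⁻¹ - ((x : ℂ) - z)⁻¹ - (w - z) * ((x : ℂ) - z)⁻¹ ^ 2
      = (w - z) ^ 2 * (((x : ℂ) - w)⁻¹ * ((x : ℂ) - z)⁻¹ ^ 2) := by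
    field_simp
    ring
  rw [this, norm_mul, norm_mul, norm_pow, norm_pow, pow_succ' η⁻¹ 2]
  gcongr <;> exact norm_inv_ofReal_sub_le hη ‹_› x

lemma hasDerivAt_stieltjes (P : Measure ℝ) [IsProbabilityMeasure P] {z : ℂ} (hz : 0 < z.im) :
    HasDerivAt (fun z : ℂ => ∫ x : ℝ, ((x : ℂ) - z)⁻¹ ∂P)
      (∫ x : ℝ, ((x : ℂ) - z)⁻¹ ^ 2 ∂P) z := by
  rw [hasDerivAt_iff_isLittleO]
  have hη : 0 < z.im / 2 := by positivity
  have hO : (fun w : ℂ => (∫ x : ℝ, ((x : ℂ) - w)⁻¹ ∂P) - (∫ x : ℝ, ((x : ℂ) - z)⁻¹ ∂P)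
      - (w - z) • ∫ x : ℝ, ((x : ℂ) - z)⁻¹ ^ 2 ∂P) =O[𝓝 z] fun w => (w - z) ^ 2 := by
    refine Asymptotics.IsBigO.of_bound ((z.im / 2)⁻¹ ^ 3) ?_
    have : ∀ᶠ w in 𝓝 z, z.im / 2 < w.im :=
      Complex.continuous_im.continuousAt.eventually (lt_mem_nhds (by linarith))
    filter_upwards [this] with w hw
    rw [norm_pow, mul_comm]
    exact norm_stieltjes_taylor_le P hη (by linarith) hw.le
  refine hO.trans_isLittleO ?_
  exact Asymptotics.isLittleO_norm_left.1
    (by simpa using Asymptotics.isLittleO_pow_sub_sub z one_lt_two)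

/-- The Stieltjes transform on one horizontal line determines a probability measure. -/
lemma ext_of_stieltjes_eq (P Q : Measure ℝ) [IsProbabilityMeasure P] [IsProbabilityMeasure Q]
    {η : ℝ} (hη : 0 < η)
    (h : ∀ z : ℂ, z.im = η → ∫ x : ℝ, ((x : ℂ) - z)⁻¹ ∂P = ∫ x : ℝ, ((x : ℂ) - z)⁻¹ ∂Q) :
    P = Q := by
  have key : ∀ (S : Measure ℝ) [IsProbabilityMeasure S] (z : ℂ), z.im = η →
      IntegrableOn (fun t : ℝ => cexp (I * z * t) * charFun S (-t)) (Set.Ioi 0) ∧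
      (∫ t in Set.Ioi (0 : ℝ), cexp (I * z * t) * charFun S (-t))
        = ∫ x : ℝ, -I * ((x : ℂ) - z)⁻¹ ∂S := by
    intro S _ z hz
    have hprod : Integrable (fun p : ℝ × ℝ => cexp (I * (z - p.2) * p.1))
        ((volume.restrict (Set.Ioi 0)).prod S) := by
      have h1 : Integrable (fun t : ℝ => Real.exp (-η * t)) (volume.restrict (Set.Ioi 0)) :=
        integrableOn_exp_mul_Ioi (by linarith) 0
      have h2 := h1.mul_prod (integrable_const (1 : ℝ) (μ := S))
      refine h2.mono' (Continuous.aestronglyMeasurable (by fun_prop)) (.of_forall fun p => ?_)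
      rw [Complex.norm_exp]
      simp [hz]
    have hinner : ∀ t : ℝ, cexp (I * z * t) * charFun S (-t)
        = ∫ x : ℝ, cexp (I * (z - x) * t) ∂S := by
      intro t
      rw [charFun_apply_real, ← integral_const_mul]
      congr with x
      rw [← Complex.exp_add]
      congr 1
      push_cast
      ring
    simp_rw [hinner]
    refine ⟨hprod.integral_prod_left, ?_⟩
    rw [integral_integral_swap hprod]
    congr with x
    have hx := sub_ne_zero_of_le_im hη hz.ge x
    have hx' : z - x ≠ 0 := by rwa [← neg_sub, neg_ne_zero]
    rw [integral_exp_mul_complex_Ioi (by simp [hz, hη])]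
    simp only [ofReal_zero, mul_zero, Complex.exp_zero]
    rw [← neg_sub z]
    field_simp
    simp
  let f : ℝ → ℂ := fun t => cexp (-(η * t)) * (charFun P (-t) - charFun Q (-t))
  have hf : ∀ z : ℂ, z.im = η → ∀ t : ℝ, cexp (z.re * t * I) * f t
      = cexp (I * z * t) * charFun P (-t) - cexp (I * z * t) * charFun Q (-t) := by
    intro z hz t
    have : I * z * t = z.re * t * I + -(η * t) := by
      conv_lhs => rw [← Complex.re_add_im z, hz]
      linear_combination (η * t : ℂ) * I_mul_I
    rw [this, Complex.exp_add]
    ring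
  have hgint : Integrable ((Set.Ioi (0 : ℝ)).indicator f) := by
    rw [integrable_indicator_iff measurableSet_Ioi]
    have hz : (η * I : ℂ).im = η := by simp
    have := (key P (η * I) hz).1.sub (key Q (η * I) hz).1
    refine this.congr (.of_forall fun t => ?_)
    have := hf (η * I) hz t
    simpa using this.symm
  have hF : 𝓕 ((Set.Ioi (0 : ℝ)).indicator f) = 0 := by
    ext ξ
    have hz : ((-2 * Real.pi * ξ : ℝ) + η * I : ℂ).im = η := by simp
    have hre : ((-2 * Real.pi * ξ : ℝ) + η * I : ℂ).re = -2 * Real.pi * ξ := by simp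
    rw [Real.fourier_real_eq_integral_exp_smul]
    have h1 : ∀ v : ℝ, cexp (↑(-2 * Real.pi * v * ξ) * I) • (Set.Ioi (0 : ℝ)).indicator f v
        = (Set.Ioi (0 : ℝ)).indicator (fun v => cexp (↑(-2 * Real.pi * v * ξ) * I) * f v) v := by
      intro v
      simp [Set.indicator_apply]
    simp_rw [h1]
    rw [integral_indicator measurableSet_Ioi]
    set z := ((-2 * Real.pi * ξ : ℝ) + η * I : ℂ)
    have h2 : ∀ v : ℝ, cexp (↑(-2 * Real.pi * v * ξ) * I) * f v
      = cexp (I * z * v) * charFun P (-v) - cexp (I * z * v) * charFun Q (-v) := by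
      intro v
      rw [← hf z hz, hre]
      congr 3
      push_cast
      ring
    simp_rw [h2]
    rw [integral_sub (key P z hz).1 (key Q z hz).1, (key P z hz).2, (key Q z hz).2,
      integral_const_mul, integral_const_mul, h z hz]
    simp
  have hfc : Continuous f := by
    have hP : Continuous (charFun P) := continuous_charFun
    have hQ : Continuous (charFun Q) := continuous_charFun
    fun_prop
  have hzero : ∀ t : ℝ, 0 < t → charFun P (-t) = charFun Q (-t) := by
    intro t ht
    have hev : (Set.Ioi (0 : ℝ)).indicator f =ᶠ[𝓝 t] f := by
      filter_upwards [Ioi_mem_nhds ht] with s hs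
      exact Set.indicator_of_mem hs f
    have hca : ContinuousAt ((Set.Ioi (0 : ℝ)).indicator f) t :=
      hfc.continuousAt.congr hev.symm
    have := hgint.fourierInv_fourier_eq (by rw [hF]; exact integrable_zero _ _ _) hca
    rw [hF, Set.indicator_of_mem (Set.mem_Ioi.2 ht), Real.fourierInv_eq] at this
    have h3 : f t = 0 := by simpa using this.symm
    simpa [f, sub_eq_zero] using h3
  refine Measure.ext_of_charFun (funext fun t => ?_)
  rcases lt_trichotomy t 0 with ht | rfl | ht
  · simpa using hzero (-t) (by linarith)
  · simp
  · have := congrArg (starRingEnd ℂ) (hzero t ht)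
    simpa [charFun_neg] using this

/-- A uniform Taylor expansion in space transfers continuity in time to the space derivative. -/
lemma continuousOn_of_taylor {K : Set ℝ} {m d : ℝ → ℂ → ℂ}
    (htaylor : ∀ t ∈ K, ∀ z w : ℂ, 1 ≤ z.im → 1 ≤ w.im →
      ‖m t w - m t z - (w - z) * d t z‖ ≤ ‖w - z‖ ^ 2)
    (hcont : ∀ z : ℂ, 1 ≤ z.im → ContinuousOn (fun t => m t z) K)
    {z : ℂ} (hz : 1 ≤ z.im) : ContinuousOn (fun t => d t z) K := by
  refine continuousOn_of_uniform_approx_of_continuousOn fun u hu => ?_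
  obtain ⟨ε, hε, hεu⟩ := Metric.mem_uniformity_dist.1 hu
  set h : ℝ := ε / 2 with hh
  have h0 : 0 < h := by positivity
  have hzh : 1 ≤ (z + h).im := by simpa using hz
  refine ⟨fun t => (m t (z + h) - m t z) / h,
    ((hcont _ hzh).sub (hcont _ hz)).div_const _, fun t ht => hεu ?_⟩
  have hT := htaylor t ht z (z + h) hz hzh
  have hne : (h : ℂ) ≠ 0 := by exact_mod_cast h0.ne'
  have hE : d t z - (m t (z + h) - m t z) / h
      = -((m t (z + h) - m t z - (z + h - z) * d t z) / h) := by
    field_simp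
    ring
  rw [dist_eq_norm, hE, norm_neg, norm_div, Complex.norm_real, Real.norm_of_nonneg h0.le,
    div_lt_iff₀ h0]
  refine hT.trans_lt ?_
  rw [add_sub_cancel_left, Complex.norm_real, Real.norm_of_nonneg h0.le]
  nlinarith

lemma norm_exp_neg_sub_le {a b : ℂ} (ha : ‖a‖ ≤ 1) (hb : ‖b‖ ≤ 1) :
    ‖cexp (-a) - cexp (-b)‖ ≤ Real.exp 1 * ‖a - b‖ := by
  have := (convex_closedBall (0 : ℂ) 1).norm_image_sub_le_of_norm_hasDerivWithin_le
    (f := cexp) (f' := cexp) (C := Real.exp 1) (x := -b) (y := -a)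
    (fun x _ => (Complex.hasDerivAt_exp x).hasDerivWithinAt)
    (fun x hx => by
      rw [Complex.norm_exp]
      exact Real.exp_le_exp.2 ((Complex.re_le_norm x).trans (by simpa using hx)))
    (by simpa using hb) (by simpa using ha)
  rwa [neg_sub_neg, norm_sub_rev b] at this

lemma norm_exp_neg_le {a : ℂ} (ha : ‖a‖ ≤ 1) : ‖cexp (-a)‖ ≤ Real.exp 1 := by
  rw [Complex.norm_exp]
  exact Real.exp_le_exp.2 ((Complex.re_le_norm _).trans (by simpa using ha))

lemma le_im_sub_mul {T s y : ℝ} {z w : ℂ} (hs0 : 0 ≤ s) (hs : s ≤ T) (hw : ‖w‖ ≤ Real.exp 1)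
    (hz : y + T * Real.exp 1 ≤ z.im) : y ≤ (z - s * w).im := by
  have h1 : w.im ≤ Real.exp 1 := (le_abs_self _).trans ((Complex.abs_im_le_norm w).trans hw)
  have h2 : s * w.im ≤ T * Real.exp 1 :=
    (mul_le_mul_of_nonneg_left h1 hs0).trans
      (mul_le_mul_of_nonneg_right hs (Real.exp_pos 1).le)
  simp
  linarith

/-- The chain rule along a straight line for a solution of the integral equation. -/
lemma hasDerivWithinAt_along_line {T : ℝ} {m d : ℝ → ℂ → ℂ}
    (htaylor : ∀ t ∈ Icc 0 T, ∀ z w : ℂ, 1 ≤ z.im → 1 ≤ w.im →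
      ‖m t w - m t z - (w - z) * d t z‖ ≤ ‖w - z‖ ^ 2)
    (hcont : ∀ z : ℂ, 1 ≤ z.im → ContinuousOn (fun t => m t z) (Icc 0 T))
    (heq : ∀ t ∈ Icc 0 T, ∀ z : ℂ, 1 ≤ z.im →
      m t z = m 0 z - ∫ s in (0 : ℝ)..t, cexp (-(m s z)) * d s z)
    {t : ℝ} (htT : t ≤ T) {z w : ℂ}
    (him : ∀ s ∈ Icc 0 t, 1 ≤ (z - ((t - s : ℝ) : ℂ) * w).im) {s₀ : ℝ} (hs₀ : s₀ ∈ Icc 0 t) :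
    HasDerivWithinAt (fun s : ℝ => m s (z - ((t - s : ℝ) : ℂ) * w))
      ((w - cexp (-(m s₀ (z - ((t - s₀ : ℝ) : ℂ) * w)))) * d s₀ (z - ((t - s₀ : ℝ) : ℂ) * w))
      (Icc 0 t) s₀ := by
  set y : ℂ := z - ((t - s₀ : ℝ) : ℂ) * w with hy
  have hy1 : 1 ≤ y.im := him s₀ hs₀
  have hsub : Icc 0 t ⊆ Icc 0 T := Icc_subset_Icc_right htT
  have hdc : ContinuousOn (fun s => d s y) (Icc 0 t) :=
    (continuousOn_of_taylor htaylor hcont hy1).mono hsub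
  have hA : HasDerivWithinAt (fun s => m s y) (-(cexp (-(m s₀ y)) * d s₀ y)) (Icc 0 t) s₀ := by
    have hFc : ContinuousOn (fun s => cexp (-(m s y)) * d s y) (Icc 0 t) :=
      ((hcont y hy1).mono hsub).neg.cexp.mul hdc
    have : Fact (s₀ ∈ Icc 0 t) := ⟨hs₀⟩
    have hI : HasDerivWithinAt (fun u => ∫ s in (0 : ℝ)..u, cexp (-(m s y)) * d s y)
        (cexp (-(m s₀ y)) * d s₀ y) (Icc 0 t) s₀ := by
      refine intervalIntegral.integral_hasDerivWithinAt_right ?_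
        (hFc.stronglyMeasurableAtFilter_nhdsWithin measurableSet_Icc s₀) (hFc s₀ hs₀)
      refine (hFc.mono ?_).intervalIntegrable
      rw [uIcc_of_le hs₀.1]
      exact Icc_subset_Icc_right hs₀.2
    exact (hI.const_sub (m 0 y)).congr (fun s hs => heq s (hsub hs) y hy1)
      (heq s₀ (hsub hs₀) y hy1)
  have hB : HasDerivWithinAt (fun s : ℝ => m s (z - ((t - s : ℝ) : ℂ) * w) - m s y)
      (w * d s₀ y) (Icc 0 t) s₀ := by
    rw [hasDerivWithinAt_iff_isLittleO]
    have h1 : (fun s : ℝ => ((s - s₀ : ℝ) : ℂ) * (w * (d s y - d s₀ y)))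
        =o[𝓝[Icc 0 t] s₀] fun s => s - s₀ := by
      have hlim : Tendsto (fun s => w * (d s y - d s₀ y)) (𝓝[Icc 0 t] s₀) (𝓝 0) := by
        have := ((hdc s₀ hs₀).tendsto.sub_const (d s₀ y)).const_mul w
        simpa using this
      have hO : (fun s : ℝ => ((s - s₀ : ℝ) : ℂ)) =O[𝓝[Icc 0 t] s₀] fun s => s - s₀ :=
        Asymptotics.isBigO_of_le _ fun s => by rw [Complex.norm_real]
      simpa using hO.mul_isLittleO ((Asymptotics.isLittleO_one_iff ℝ).2 hlim)
    have h2 : (fun s : ℝ => m s (z - ((t - s : ℝ) : ℂ) * w) - m s y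
        - ((s - s₀ : ℝ) : ℂ) * w * d s y) =o[𝓝[Icc 0 t] s₀] fun s => s - s₀ := by
      have hO : (fun s : ℝ => m s (z - ((t - s : ℝ) : ℂ) * w) - m s y
          - ((s - s₀ : ℝ) : ℂ) * w * d s y) =O[𝓝[Icc 0 t] s₀] fun s => ‖s - s₀‖ ^ 2 := by
        refine Asymptotics.IsBigO.of_bound (‖w‖ ^ 2) ?_
        filter_upwards [self_mem_nhdsWithin] with s hs
        have hd : z - ((t - s : ℝ) : ℂ) * w - y = ((s - s₀ : ℝ) : ℂ) * w := by
          rw [hy]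
          push_cast
          ring
        have := htaylor s (hsub hs) y _ hy1 (him s hs)
        rw [hd, norm_mul, Complex.norm_real] at this
        rw [norm_pow, norm_norm]
        linarith [mul_pow ‖s - s₀‖ ‖w‖ 2]
      exact hO.trans_isLittleO
        ((Asymptotics.isLittleO_pow_sub_sub s₀ one_lt_two).mono nhdsWithin_le_nhds)
    refine (h1.add h2).congr_left fun s => ?_
    rw [← hy, Complex.real_smul]
    ring
  have := hA.add hB
  refine (this.congr_deriv ?_).congr (fun s _ => ?_) ?_
  · ring
  · simp
  · simp

/-- Solutions are constant along the (straight) characteristics. -/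
lemma eq_along_characteristic {T : ℝ} {m d : ℝ → ℂ → ℂ}
    (hm : ∀ t ∈ Icc 0 T, ∀ z : ℂ, 1 ≤ z.im → ‖m t z‖ ≤ 1)
    (hd : ∀ t ∈ Icc 0 T, ∀ z : ℂ, 1 ≤ z.im → ‖d t z‖ ≤ 1)
    (htaylor : ∀ t ∈ Icc 0 T, ∀ z w : ℂ, 1 ≤ z.im → 1 ≤ w.im →
      ‖m t w - m t z - (w - z) * d t z‖ ≤ ‖w - z‖ ^ 2)
    (hcont : ∀ z : ℂ, 1 ≤ z.im → ContinuousOn (fun t => m t z) (Icc 0 T))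
    (heq : ∀ t ∈ Icc 0 T, ∀ z : ℂ, 1 ≤ z.im →
      m t z = m 0 z - ∫ s in (0 : ℝ)..t, cexp (-(m s z)) * d s z)
    {t : ℝ} (ht : t ∈ Icc 0 T) {z : ℂ} (hz : 1 + T * Real.exp 1 ≤ z.im) :
    m 0 (z - t * cexp (-(m t z))) = m t z := by
  have hz1 : 1 ≤ z.im := by
    have : 0 ≤ T * Real.exp 1 := mul_nonneg (ht.1.trans ht.2) (Real.exp_pos 1).le
    linarith
  set c := m t z with hc
  have hc1 : ‖c‖ ≤ 1 := hm t ht z hz1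
  set w := cexp (-c) with hw
  have him : ∀ s ∈ Icc 0 t, 1 ≤ (z - ((t - s : ℝ) : ℂ) * w).im := fun s hs =>
    le_im_sub_mul (sub_nonneg.2 hs.2) (by linarith [hs.1, ht.2]) (norm_exp_neg_le hc1) hz
  have hsub : Icc 0 t ⊆ Icc 0 T := Icc_subset_Icc_right ht.2
  have hder := fun s (hs : s ∈ Icc 0 t) =>
    hasDerivWithinAt_along_line htaylor hcont heq ht.2 him hs
  have hmaps : MapsTo (fun u => t - u) (Icc 0 t) (Icc 0 t) := fun u hu =>
    ⟨by linarith [hu.2], by linarith [hu.1]⟩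
  let G : ℝ → ℂ := fun s => m s (z - ((t - s : ℝ) : ℂ) * w)
  let G' : ℝ → ℂ := fun s => (w - cexp (-(G s))) * d s (z - ((t - s : ℝ) : ℂ) * w)
  have hH : ∀ u ∈ Icc 0 t, HasDerivWithinAt (fun u => G (t - u) - c) (-G' (t - u)) (Icc 0 t) u := by
    intro u hu
    have h1 : HasDerivWithinAt (fun u : ℝ => t - u) (-1) (Icc 0 t) u :=
      (hasDerivWithinAt_id u _).const_sub t
    have h2 := HasDerivWithinAt.scomp u (hder (t - u) (hmaps hu)) h1 hmaps
    exact (h2.sub_const c).congr_deriv (by simp [G', G])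
  have hzero := eq_zero_of_abs_deriv_le_mul_abs_self_of_eq_zero_right
    (f := fun u => G (t - u) - c) (f' := fun u => -G' (t - u)) (K := Real.exp 1) (a := 0) (b := t)
    (fun u hu => (hH u hu).continuousWithinAt)
    (fun u hu => (hH u (Ico_subset_Icc_self hu)).mono_of_mem_nhdsWithin
      (mem_of_superset (Icc_mem_nhdsGE hu.2) (Icc_subset_Icc_left hu.1)))
    (by simp [G, hc]) (fun u hu => by
      have hu' := hmaps (Ico_subset_Icc_self hu)
      have hG1 : ‖G (t - u)‖ ≤ 1 := hm _ (hsub hu') _ (him _ hu')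
      have hd1 := hd _ (hsub hu') _ (him _ hu')
      rw [norm_neg, norm_mul, ← mul_one (Real.exp 1 * _), norm_sub_rev (G (t - u))]
      exact mul_le_mul (norm_exp_neg_sub_le hc1 hG1) hd1 (norm_nonneg _) (by positivity))
    t ⟨ht.1, le_rfl⟩
  simpa [G, sub_eq_zero] using hzero

end StieltjesBurgers

/-- Theorem 2.1 (uniqueness): two families of probability measures with density at most `1`
and the same initial measure, whose Stieltjes transforms are continuous in `t` and solve the
integral equation `m_t(z) = m_0(z) − ∫_0^t e^{−m_s(z)} ∂_z m_s(z) ds` on `ℂ ∖ ℝ`, coincide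
for all `t ∈ [0,T]`. -/
theorem stmt10 (T : ℝ) (hT : 0 < T)
    (μ ν : ℝ → Measure ℝ)
    (hμprob : ∀ t ∈ Set.Icc (0 : ℝ) T, IsProbabilityMeasure (μ t))
    (hνprob : ∀ t ∈ Set.Icc (0 : ℝ) T, IsProbabilityMeasure (ν t))
    (hμac : ∀ t ∈ Set.Icc (0 : ℝ) T, μ t ≪ volume)
    (hνac : ∀ t ∈ Set.Icc (0 : ℝ) T, ν t ≪ volume)
    (hμd : ∀ t ∈ Set.Icc (0 : ℝ) T, ∀ᵐ x ∂volume, (μ t).rnDeriv volume x ≤ 1)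
    (hνd : ∀ t ∈ Set.Icc (0 : ℝ) T, ∀ᵐ x ∂volume, (ν t).rnDeriv volume x ≤ 1)
    (h0 : μ 0 = ν 0)
    (M N : ℝ → ℂ → ℂ)
    (hM : ∀ t : ℝ, ∀ z : ℂ, M t z = ∫ x : ℝ, ((x : ℂ) - z)⁻¹ ∂(μ t))
    (hN : ∀ t : ℝ, ∀ z : ℂ, N t z = ∫ x : ℝ, ((x : ℂ) - z)⁻¹ ∂(ν t))
    (hMcont : ∀ z : ℂ, z.im ≠ 0 → ContinuousOn (fun t : ℝ => M t z) (Set.Icc 0 T))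
    (hNcont : ∀ z : ℂ, z.im ≠ 0 → ContinuousOn (fun t : ℝ => N t z) (Set.Icc 0 T))
    (hMeq : ∀ t ∈ Set.Icc (0 : ℝ) T, ∀ z : ℂ, z.im ≠ 0 →
      M t z = M 0 z - ∫ s in (0 : ℝ)..t, Complex.exp (-(M s z)) * deriv (M s) z)
    (hNeq : ∀ t ∈ Set.Icc (0 : ℝ) T, ∀ z : ℂ, z.im ≠ 0 →
      N t z = N 0 z - ∫ s in (0 : ℝ)..t, Complex.exp (-(N s z)) * deriv (N s) z) :
    ∀ t ∈ Set.Icc (0 : ℝ) T, μ t = ν t := by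
  open StieltjesBurgers Set in
  intro t ht
  have h0T : (0 : ℝ) ∈ Icc (0 : ℝ) T := ⟨le_rfl, hT.le⟩
  have key : ∀ (ρ : ℝ → Measure ℝ) (m : ℝ → ℂ → ℂ),
      (∀ t ∈ Icc (0 : ℝ) T, IsProbabilityMeasure (ρ t)) →
      (∀ t : ℝ, ∀ z : ℂ, m t z = ∫ x : ℝ, ((x : ℂ) - z)⁻¹ ∂(ρ t)) →
      (∀ z : ℂ, z.im ≠ 0 → ContinuousOn (fun t : ℝ => m t z) (Icc 0 T)) →
      (∀ t ∈ Icc (0 : ℝ) T, ∀ z : ℂ, z.im ≠ 0 →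
        m t z = m 0 z - ∫ s in (0 : ℝ)..t, Complex.exp (-(m s z)) * deriv (m s) z) →
      ∀ z : ℂ, 1 + T * Real.exp 1 ≤ z.im → m 0 (z - t * Complex.exp (-(m t z))) = m t z := by
    intro ρ m hρ hm hc he z hz
    have hpos : ∀ z : ℂ, 1 ≤ z.im → 0 < z.im := fun z hz => one_pos.trans_le hz
    have hderiv : ∀ s ∈ Icc (0 : ℝ) T, ∀ z : ℂ, 1 ≤ z.im →
        deriv (m s) z = ∫ x : ℝ, ((x : ℂ) - z)⁻¹ ^ 2 ∂(ρ s) := by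
      intro s hs z hz
      have := hρ s hs
      rw [funext (hm s)]
      exact (hasDerivAt_stieltjes (ρ s) (hpos z hz)).deriv
    refine eq_along_characteristic (d := fun s => deriv (m s)) ?_ ?_ ?_
      (fun z hz => hc z (hpos z hz).ne') (fun s hs z hz => he s hs z (hpos z hz).ne') ht hz
    · intro s hs z hz
      have := hρ s hs
      simpa [hm] using norm_stieltjes_le (ρ s) one_pos hz
    · intro s hs z hz
      have := hρ s hs
      rw [hderiv s hs z hz]
      simpa using norm_integral_inv_pow_le (ρ s) one_pos hz 2
    · intro s hs z w hz hw
      have := hρ s hs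
      rw [hderiv s hs z hz, hm, hm]
      simpa using norm_stieltjes_taylor_le (ρ s) one_pos hz hw
  have := hμprob t ht
  have := hνprob t ht
  have := hμprob 0 h0T
  set e := Real.exp 1
  have he : 0 < T * e := mul_pos hT (Real.exp_pos 1)
  set η := 1 + T * e with hη
  have hη0 : 0 < η := by linarith
  refine ext_of_stieltjes_eq (μ t) (ν t) (η := η + T * e) (by linarith) fun z hz => ?_
  have hM1 : ‖M t z‖ ≤ 1 := by
    simpa [hM] using norm_stieltjes_le (μ t) one_pos (show 1 ≤ z.im by linarith)
  have hN1 : ‖N t z‖ ≤ 1 := by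
    simpa [hN] using norm_stieltjes_le (ν t) one_pos (show 1 ≤ z.im by linarith)
  have hMN0 : ∀ z, N 0 z = M 0 z := fun z => by rw [hM, hN, h0]
  have kM := key μ M hμprob hM hMcont hMeq z (by linarith)
  have kN := key ν N hνprob hN hNcont hNeq z (by linarith)
  rw [hMN0] at kN
  have hlip := norm_stieltjes_sub_le (μ 0) hη0
    (le_im_sub_mul ht.1 ht.2 (norm_exp_neg_le hN1) hz.ge)
    (le_im_sub_mul ht.1 ht.2 (norm_exp_neg_le hM1) hz.ge)
  rw [← hM, ← hM, kM, kN, sub_sub_sub_cancel_left, ← mul_sub, norm_mul, Complex.norm_real,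
    Real.norm_of_nonneg ht.1, norm_sub_rev] at hlip
  have hexp := norm_exp_neg_sub_le hN1 hM1
  rw [norm_sub_rev (N t z)] at hexp
  have hle : ‖M t z - N t z‖ ≤ T * e * η⁻¹ ^ 2 * ‖M t z - N t z‖ := by
    refine (norm_sub_rev _ _).trans_le (hlip.trans ?_)
    calc _ ≤ T * (e * ‖M t z - N t z‖) * η⁻¹ ^ 2 := by
          gcongr
          exact ht.2
      _ = _ := by ring
  have hlt : T * e * η⁻¹ ^ 2 < 1 := by
    rw [inv_pow, ← div_eq_mul_inv, div_lt_one (by positivity)]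
    nlinarith
  have hnz : ‖M t z - N t z‖ = 0 := by
    nlinarith [norm_nonneg (M t z - N t z)]
  rw [← hM, ← hN]
  exact sub_eq_zero.1 (norm_eq_zero.1 hnz)
end

section
/- For t > 0 define f_t : ℝ → ℝ as follows, where arccot(u) = π/2 − arctan(u) ∈ (0, π): f_t(x) = (1/π)·arccot((x + t − 1)/√(4xt − (x + t − 1)²)) if (√t − 1)² < x < (√t + 1)²; f_t(x) = 1 if t < 1 and 0 ≤ x ≤ (1 − √t)²; and f_t(x) = 0 otherwise. Then 0 ≤ f_t ≤ 1, ∫_ℝ f_t(x) dx = 1, and the Stieltjes transform m(z) = ∫_ℝ f_t(x)/(x − z) dx satisfies z·e^{2m(z)} + (1 − t − z)·e^{m(z)} + t = 0 for every z ∈ ℂ ∖ ℝ. -/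
open MeasureTheory

open Complex in
/-- The argument of a point of the upper half plane as an inverse cotangent. -/
theorem pi_div_two_sub_arctan_eq_arg {z : ℂ} (hz : 0 < z.im) :
    Real.pi / 2 - Real.arctan (z.re / z.im) = arg z := by
  have h0 : z ≠ 0 := by rintro rfl; simp at hz
  have h1 : 0 < arg z := by
    rcases (arg_nonneg_iff.2 hz.le).lt_or_eq with h | h
    · exact h
    · exact absurd (arg_eq_zero_iff.1 h.symm).2 hz.ne'
  have h2 : arg z < Real.pi := arg_lt_pi_iff.2 (Or.inr hz.ne')
  have h3 : z.re / z.im = Real.tan (Real.pi / 2 - arg z) := by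
    rw [Real.tan_pi_div_two_sub, tan_arg, inv_div]
  rw [h3, Real.arctan_tan (by linarith) (by linarith)]
  ring

open Complex in
theorem arg_add_cexp_eq_sub (r φ : ℝ) (hr : 0 < r) (h0 : 0 < φ) (hπ : φ < Real.pi) :
    arg (r + cexp (φ * I)) = φ - arg (1 + r * cexp (φ * I)) := by
  have hs := Real.sin_pos_of_pos_of_lt_pi h0 hπ
  set w : ℂ := 1 + r * cexp (φ * I) with hw
  have him : w.im = r * Real.sin φ := by simp [hw, exp_ofReal_mul_I_im]
  have hwim : 0 < w.im := him ▸ mul_pos hr hs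
  have hw0 : w ≠ 0 := fun h => by simp [h] at hwim
  have h1 : 0 ≤ arg w := arg_nonneg_iff.2 hwim.le
  have h2 : arg w < Real.pi := arg_lt_pi_iff.2 (Or.inr hwim.ne')
  have key : (r : ℂ) + cexp (φ * I) = ‖w‖ * cexp ((φ - arg w : ℝ) * I) := by
    have hconj : (starRingEnd ℂ) w = 1 + r * cexp (-(φ * I)) := by
      simp [hw, ← exp_conj]
    have hpol : (starRingEnd ℂ) w = ‖w‖ * cexp (-(arg w * I)) := by
      have h := congrArg (starRingEnd ℂ) (norm_mul_exp_arg_mul_I w)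
      rw [← h, map_mul, ← exp_conj]
      simp
    have : ((φ - arg w : ℝ) : ℂ) * I = φ * I + -(arg w * I) := by push_cast; ring
    rw [this, exp_add, mul_left_comm, ← hpol, hconj, mul_add, mul_left_comm, ← exp_add]
    simp [add_comm]
  rw [key, exp_mul_I]
  exact_mod_cast arg_mul_cos_add_sin_mul_I (norm_pos_iff.2 hw0)
    (θ := φ - arg w) ⟨by linarith, by linarith⟩

open Complex in
theorem one_add_mul_mem_slitPlane {s : ℝ} {ζ : ℂ} (hs0 : 0 ≤ s) (hs : s < 1) (hζ : ‖ζ‖ ≤ 1) :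
    1 + s * ζ ∈ slitPlane := by
  left
  have h1 : -1 ≤ ζ.re := by
    have := abs_le.1 ((abs_re_le_norm ζ).trans hζ)
    exact this.1
  simp only [add_re, one_re, re_ofReal_mul]
  nlinarith

open Complex Metric in
/-- An integral of `arg (1 + s e^{iφ})` over the upper half circle as a circle average. -/
theorem integral_arg_mul_eq_circleAverage {s : ℝ} (hs0 : 0 ≤ s) (hs : s < 1) {G : ℂ → ℂ}
    (hG : ContinuousOn G (sphere 0 1)) :
    ∫ φ in (0 : ℝ)..Real.pi, (arg (1 + s * cexp (φ * I)) : ℂ) *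
        ((G (cexp (φ * I)) - G (cexp (-(φ * I)))) / I) =
      -Real.pi * Real.circleAverage (fun ζ => log (1 + s * ζ) * (G ζ - G ζ⁻¹)) 0 1 := by
  set H : ℂ → ℂ := fun ζ => log (1 + s * ζ) * (G ζ - G ζ⁻¹) with hH
  have hcH : Continuous fun φ : ℝ => H (circleMap 0 1 φ) := by
    have hc := continuous_circleMap (0 : ℂ) 1
    have hm : ∀ φ : ℝ, circleMap 0 1 φ ∈ sphere (0 : ℂ) 1 := fun φ => by simp
    refine (Continuous.clog (by fun_prop) fun φ => ?_).mul (.sub ?_ ?_)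
    · exact one_add_mul_mem_slitPlane hs0 hs (by simp)
    · exact hG.comp_continuous hc hm
    · exact hG.comp_continuous (hc.inv₀ fun φ => by simp [circleMap]) fun φ => by simp
  have hsplit : ∫ φ in (0 : ℝ)..2 * Real.pi, H (circleMap 0 1 φ) =
      ∫ φ in (0 : ℝ)..Real.pi, (H (circleMap 0 1 φ) + H (circleMap 0 1 (2 * Real.pi - φ))) := by
    have hcH' : Continuous fun φ : ℝ => H (circleMap 0 1 (2 * Real.pi - φ)) :=
      hcH.comp (by fun_prop : Continuous fun φ : ℝ => 2 * Real.pi - φ)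
    rw [intervalIntegral.integral_add (hcH.intervalIntegrable _ _) (hcH'.intervalIntegrable _ _),
      intervalIntegral.integral_comp_sub_left (fun φ => H (circleMap 0 1 φ)),
      ← intervalIntegral.integral_add_adjacent_intervals (hcH.intervalIntegrable 0 Real.pi)
        (hcH.intervalIntegrable Real.pi (2 * Real.pi))]
    congr 2 <;> ring
  have hpt : ∀ φ : ℝ, H (circleMap 0 1 φ) + H (circleMap 0 1 (2 * Real.pi - φ)) =
      -2 * ((arg (1 + s * cexp (φ * I)) : ℂ) *
        ((G (cexp (φ * I)) - G (cexp (-(φ * I)))) / I)) := by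
    intro φ
    have e1 : circleMap 0 1 φ = cexp (φ * I) := by simp [circleMap]
    have e2 : circleMap 0 1 (2 * Real.pi - φ) = cexp (-(φ * I)) := by
      simp only [circleMap, ofReal_one, one_mul, zero_add]
      push_cast
      rw [sub_mul, exp_sub, exp_two_pi_mul_I, exp_neg, one_div]
    have hmem : 1 + s * cexp (φ * I) ∈ slitPlane :=
      one_add_mul_mem_slitPlane hs0 hs (norm_exp_ofReal_mul_I φ).le
    have e3 : log (1 + s * cexp (-(φ * I))) = (starRingEnd ℂ) (log (1 + s * cexp (φ * I))) := by
      rw [← log_conj _ (slitPlane_arg_ne_pi hmem)]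
      simp [← exp_conj]
    have e4 : log (1 + s * cexp (φ * I)) - (starRingEnd ℂ) (log (1 + s * cexp (φ * I))) =
        2 * arg (1 + s * cexp (φ * I)) * I := by
      rw [sub_conj, log_im]; push_cast; ring
    rw [e1, e2]
    simp only [hH, e3]
    simp only [exp_neg, inv_inv]
    have hI : ∀ x y : ℂ, -2 * (x * (y / I)) = y * (2 * x * I) := fun x y => by
      rw [div_I]; ring
    rw [hI, ← e4]
    ring
  rw [Real.circleAverage_def, hsplit]
  simp only [hpt]
  rw [intervalIntegral.integral_const_mul, real_smul]
  generalize ∫ φ in (0 : ℝ)..Real.pi, (arg (1 + s * cexp (φ * I)) : ℂ) *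
        ((G (cexp (φ * I)) - G (cexp (-(φ * I)))) / I) = J
  have : (Real.pi : ℂ) ≠ 0 := by exact_mod_cast Real.pi_ne_zero
  push_cast
  field_simp

theorem one_sub_mul_ne_zero {a ζ : ℂ} (ha : ‖a‖ < 1) (hζ : ‖ζ‖ ≤ 1) : 1 - a * ζ ≠ 0 := by
  intro h
  have h1 : ‖a * ζ‖ = 1 := by rw [← sub_eq_zero.1 h]; simp
  rw [norm_mul] at h1
  nlinarith [norm_nonneg a, norm_nonneg ζ]

open Complex Metric in
theorem differentiableOn_log_one_add_mul {s : ℝ} (hs0 : 0 ≤ s) (hs : s < 1) :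
    DifferentiableOn ℂ (fun ζ : ℂ => log (1 + s * ζ)) (closedBall 0 1) :=
  DifferentiableOn.clog (by fun_prop) fun ζ hζ =>
    one_add_mul_mem_slitPlane hs0 hs (by simpa using hζ)

open Complex Metric in
theorem integral_arg_mul_cauchy_kernel_of_lt {s : ℝ} (hs0 : 0 ≤ s) (hs : s < 1) {a : ℂ}
    (ha : ‖a‖ < 1) :
    ∫ φ in (0 : ℝ)..Real.pi, (arg (1 + s * cexp (φ * I)) : ℂ) *
        (((1 - a * cexp (φ * I))⁻¹ - (1 - a * cexp (-(φ * I)))⁻¹) / I) =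
      Real.pi * log (1 + s * a) := by
  have hne : ∀ ζ ∈ closedBall (0 : ℂ) 1, 1 - a * ζ ≠ 0 := fun ζ hζ =>
    one_sub_mul_ne_zero ha (by simpa using hζ)
  have hd : DifferentiableOn ℂ (fun ζ : ℂ => (1 - a * ζ)⁻¹) (closedBall 0 1) :=
    DifferentiableOn.inv (by fun_prop) hne
  have hl := differentiableOn_log_one_add_mul hs0 hs
  rw [integral_arg_mul_eq_circleAverage hs0 hs (G := fun ζ => (1 - a * ζ)⁻¹)
    (hd.continuousOn.mono sphere_subset_closedBall)]
  have hcl : closure (ball (0 : ℂ) |1|) = closedBall 0 1 := by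
    rw [closure_ball _ (by simp), abs_one]
  have A1 : Real.circleAverage (fun ζ => log (1 + s * ζ) * (1 - a * ζ)⁻¹) 0 1 = 0 := by
    rw [DiffContOnCl.circleAverage]
    · simp
    · exact DifferentiableOn.diffContOnCl (by rw [hcl]; exact hl.mul hd)
  have A2 : Real.circleAverage (fun ζ : ℂ => ((ζ - 0) / (ζ - a)) • log (1 + s * ζ)) 0 1 =
      log (1 + s * a) :=
    DiffContOnCl.circleAverage_smul_div
      (DifferentiableOn.diffContOnCl (by rw [hcl]; exact hl)) (by simpa using ha)
  have hza : ∀ ζ ∈ sphere (0 : ℂ) 1, ζ - a ≠ 0 := by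
    intro ζ hζ h
    rw [sub_eq_zero.1 h] at hζ
    simp at hζ; linarith
  have hsub : Real.circleAverage
      (fun ζ => log (1 + s * ζ) * ((1 - a * ζ)⁻¹ - (1 - a * ζ⁻¹)⁻¹)) 0 1 =
      Real.circleAverage (fun ζ => log (1 + s * ζ) * (1 - a * ζ)⁻¹) 0 1 -
        Real.circleAverage (fun ζ : ℂ => ((ζ - 0) / (ζ - a)) • log (1 + s * ζ)) 0 1 := by
    rw [← Real.circleAverage_fun_sub (E := ℂ)]
    · apply Real.circleAverage_congr_sphere
      intro ζ hζ
      rw [abs_one] at hζ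
      have h0 : ζ ≠ 0 := by rintro rfl; simp at hζ
      have h1 := hza ζ hζ
      have h2 : (1 - a * ζ⁻¹)⁻¹ = ζ / (ζ - a) := by
        rw [show 1 - a * ζ⁻¹ = (ζ - a) / ζ by field_simp, inv_div]
      simp only [h2, smul_eq_mul, sub_zero]
      ring
    · refine ContinuousOn.circleIntegrable (by simp) ?_
      exact (hl.mul hd).continuousOn.mono sphere_subset_closedBall
    · refine ContinuousOn.circleIntegrable (by simp) ?_
      exact (ContinuousOn.div (by fun_prop) (by fun_prop) hza).smul
        (hl.continuousOn.mono sphere_subset_closedBall)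
  rw [hsub, A1, A2]; ring

open Complex Metric in
theorem integral_arg_mul_sin_of_lt {s : ℝ} (hs0 : 0 ≤ s) (hs : s < 1) :
    ∫ φ in (0 : ℝ)..Real.pi, (arg (1 + s * cexp (φ * I)) : ℂ) *
        ((cexp (φ * I) - cexp (-(φ * I))) / I) = Real.pi * s := by
  have hl := differentiableOn_log_one_add_mul hs0 hs
  rw [integral_arg_mul_eq_circleAverage hs0 hs (G := fun ζ => ζ) (by fun_prop)]
  have hcl : closure (ball (0 : ℂ) |1|) = closedBall 0 1 := by
    rw [closure_ball _ (by simp), abs_one]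
  have A1 : Real.circleAverage (fun ζ : ℂ => log (1 + s * ζ) * ζ) 0 1 = 0 := by
    rw [DiffContOnCl.circleAverage]
    · simp
    · exact DifferentiableOn.diffContOnCl (by rw [hcl]; exact hl.mul (by fun_prop))
  have hds : DifferentiableOn ℂ (dslope (fun ζ : ℂ => log (1 + s * ζ)) 0) (closedBall 0 1) :=
    (Complex.differentiableOn_dslope (closedBall_mem_nhds _ one_pos)).2 hl
  have A2 : Real.circleAverage (dslope (fun ζ : ℂ => log (1 + s * ζ)) 0) 0 1 = s := by
    rw [DiffContOnCl.circleAverage (DifferentiableOn.diffContOnCl (by rw [hcl]; exact hds)),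
      dslope_same]
    have : HasDerivAt (fun ζ : ℂ => 1 + s * ζ) s 0 := by
      simpa using ((hasDerivAt_id (0 : ℂ)).const_mul (s : ℂ)).const_add 1
    simpa using (this.clog (by simp)).deriv
  have hsub : Real.circleAverage (fun ζ => log (1 + s * ζ) * (ζ - ζ⁻¹)) 0 1 =
      Real.circleAverage (fun ζ : ℂ => log (1 + s * ζ) * ζ) 0 1 -
        Real.circleAverage (dslope (fun ζ : ℂ => log (1 + s * ζ)) 0) 0 1 := by
    rw [← Real.circleAverage_fun_sub (E := ℂ)]
    · apply Real.circleAverage_congr_sphere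
      intro ζ hζ
      rw [abs_one] at hζ
      have h0 : ζ ≠ 0 := by rintro rfl; simp at hζ
      simp only [dslope_of_ne _ h0, slope_def_field, mul_zero, add_zero, log_one, sub_zero]
      ring
    · refine ContinuousOn.circleIntegrable (by simp) ?_
      exact (hl.mul differentiableOn_id).continuousOn.mono sphere_subset_closedBall
    · exact ContinuousOn.circleIntegrable (by simp)
        (hds.continuousOn.mono sphere_subset_closedBall)
  rw [hsub, A1, A2]; ring

open Complex Set Filter Topology in
/-- The integrals of `arg (1 + s e^{iφ})` over the upper half circle are left continuous in `s`
at `s = 1`. -/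
theorem tendsto_integral_arg_mul {K : ℝ → ℂ} (hK : Continuous K) :
    Tendsto (fun s : ℝ => ∫ φ in (0 : ℝ)..Real.pi, (arg (1 + s * cexp (φ * I)) : ℂ) * K φ)
      (𝓝[<] 1) (𝓝 (∫ φ in (0 : ℝ)..Real.pi, (arg (1 + (1 : ℝ) * cexp (φ * I)) : ℂ) * K φ)) := by
  refine intervalIntegral.tendsto_integral_filter_of_dominated_convergence
    (fun φ => Real.pi * ‖K φ‖) ?_ ?_ ?_ ?_
  · refine Eventually.of_forall fun s => ?_
    refine Measurable.aestronglyMeasurable ?_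
    have := hK.measurable
    fun_prop
  · refine Eventually.of_forall fun s => Eventually.of_forall fun φ _ => ?_
    rw [norm_mul, norm_real]
    exact mul_le_mul_of_nonneg_right (abs_arg_le_pi _) (norm_nonneg _)
  · exact (by fun_prop : Continuous fun φ => Real.pi * ‖K φ‖).intervalIntegrable _ _
  · have hne : ∀ᵐ φ : ℝ, φ ≠ Real.pi := by simp [ae_iff, measure_singleton]
    filter_upwards [hne] with φ hφ hmem
    rw [uIoc_of_le Real.pi_pos.le] at hmem
    have hsin := Real.sin_pos_of_pos_of_lt_pi hmem.1 (lt_of_le_of_ne hmem.2 hφ)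
    have hsp : 1 + ((1 : ℝ) : ℂ) * cexp (φ * I) ∈ slitPlane := by
      right
      simpa [exp_ofReal_mul_I_im] using hsin.ne'
    refine Tendsto.mul_const _ ?_
    have h1 : ContinuousAt (fun s : ℝ => 1 + (s : ℂ) * cexp (φ * I)) 1 := by fun_prop
    have h2 := (continuousAt_arg hsp).comp_of_eq h1 rfl
    exact (continuous_ofReal.continuousAt.comp_of_eq h2 rfl).tendsto.mono_left nhdsWithin_le_nhds

open Complex Filter Topology in
theorem integral_arg_mul_cauchy_kernel {s : ℝ} (hs0 : 0 ≤ s) (hs : s ≤ 1) {a : ℂ}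
    (ha : ‖a‖ < 1) :
    ∫ φ in (0 : ℝ)..Real.pi, (arg (1 + s * cexp (φ * I)) : ℂ) *
        (((1 - a * cexp (φ * I))⁻¹ - (1 - a * cexp (-(φ * I)))⁻¹) / I) =
      Real.pi * log (1 + s * a) := by
  rcases hs.lt_or_eq with hs | rfl
  · exact integral_arg_mul_cauchy_kernel_of_lt hs0 hs ha
  have hK : Continuous fun φ : ℝ =>
      ((1 - a * cexp (φ * I))⁻¹ - (1 - a * cexp (-(φ * I)))⁻¹) / I := by
    refine Continuous.div_const (.sub (.inv₀ (by fun_prop) fun φ => ?_)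
      (.inv₀ (by fun_prop) fun φ => ?_)) _
    · exact one_sub_mul_ne_zero ha (norm_exp_ofReal_mul_I φ).le
    · exact one_sub_mul_ne_zero ha (by simpa using (norm_exp_ofReal_mul_I (-φ)).le)
  have hsp : 1 + ((1 : ℝ) : ℂ) * a ∈ slitPlane := by
    left
    have := (abs_lt.1 ((abs_re_le_norm a).trans_lt ha)).1
    simp only [ofReal_one, one_mul, add_re, one_re]
    linarith
  have hc : ContinuousAt (fun s : ℝ => (Real.pi : ℂ) * log (1 + s * a)) 1 :=
    continuousAt_const.mul (ContinuousAt.clog (by fun_prop) hsp)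
  refine tendsto_nhds_unique ((tendsto_integral_arg_mul hK).congr' ?_)
    (hc.tendsto.mono_left nhdsWithin_le_nhds)
  filter_upwards [Ioo_mem_nhdsLT zero_lt_one] with s hs
  exact integral_arg_mul_cauchy_kernel_of_lt hs.1.le hs.2 ha

open Complex Filter Topology in
theorem integral_arg_mul_sin {s : ℝ} (hs0 : 0 ≤ s) (hs : s ≤ 1) :
    ∫ φ in (0 : ℝ)..Real.pi, (arg (1 + s * cexp (φ * I)) : ℂ) *
        ((cexp (φ * I) - cexp (-(φ * I))) / I) = Real.pi * s := by
  rcases hs.lt_or_eq with hs | rfl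
  · exact integral_arg_mul_sin_of_lt hs0 hs
  have hK : Continuous fun φ : ℝ => (cexp (φ * I) - cexp (-(φ * I))) / I :=
    Continuous.div_const (by fun_prop) _
  have hc : ContinuousAt (fun s : ℝ => (Real.pi : ℂ) * s) 1 := by fun_prop
  refine tendsto_nhds_unique ((tendsto_integral_arg_mul hK).congr' ?_)
    (hc.tendsto.mono_left nhdsWithin_le_nhds)
  filter_upwards [Ioo_mem_nhdsLT zero_lt_one] with s hs
  exact integral_arg_mul_sin_of_lt hs.1.le hs.2

open Complex in
theorem integral_arg_add_cexp_of_one_le {r : ℝ} (hr : 1 ≤ r) (K : ℝ → ℂ) :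
    ∫ φ in (0 : ℝ)..Real.pi, (arg (r + cexp (φ * I)) : ℂ) * K φ =
      ∫ φ in (0 : ℝ)..Real.pi, (arg (1 + (r⁻¹ : ℝ) * cexp (φ * I)) : ℂ) * K φ := by
  have hr0 : 0 < r := by linarith
  have hrc : (r : ℂ) ≠ 0 := by exact_mod_cast hr0.ne'
  congr 1 with φ
  rw [← arg_real_mul (1 + (r⁻¹ : ℝ) * cexp (φ * I)) hr0]
  congr 3
  push_cast
  field_simp

open Complex in
theorem intervalIntegrable_arg_mul (s : ℝ) {K : ℝ → ℂ} (hK : Continuous K) :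
    IntervalIntegrable (fun φ : ℝ => (arg (1 + s * cexp (φ * I)) : ℂ) * K φ) volume
      0 Real.pi := by
  refine IntervalIntegrable.mono_fun' (g := fun φ => Real.pi * ‖K φ‖)
    ((by fun_prop : Continuous fun φ => Real.pi * ‖K φ‖).intervalIntegrable _ _) ?_ ?_
  · refine Measurable.aestronglyMeasurable ?_
    have := hK.measurable
    fun_prop
  · refine Filter.Eventually.of_forall fun φ => ?_
    simp only [norm_mul, norm_real]
    exact mul_le_mul_of_nonneg_right (abs_arg_le_pi _) (norm_nonneg _)

open Complex in
theorem integral_arg_add_cexp {r : ℝ} (hr : 0 < r) {K : ℝ → ℂ} (hK : Continuous K) :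
    ∫ φ in (0 : ℝ)..Real.pi, (arg (r + cexp (φ * I)) : ℂ) * K φ =
      2 * (∫ φ in (0 : ℝ)..Real.pi, (arg (1 + (1 : ℝ) * cexp (φ * I)) : ℂ) * K φ) -
        ∫ φ in (0 : ℝ)..Real.pi, (arg (1 + r * cexp (φ * I)) : ℂ) * K φ := by
  rw [← intervalIntegral.integral_const_mul, ← intervalIntegral.integral_sub
    ((intervalIntegrable_arg_mul 1 hK).const_mul _) (intervalIntegrable_arg_mul r hK)]
  refine intervalIntegral.integral_congr_ae ?_
  have hne : ∀ᵐ φ : ℝ, φ ≠ Real.pi := by simp [ae_iff, measure_singleton]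
  filter_upwards [hne] with φ hφ hmem
  rw [Set.uIoc_of_le Real.pi_pos.le] at hmem
  have hφ' := lt_of_le_of_ne hmem.2 hφ
  have h1 := arg_add_cexp_eq_sub r φ hr hmem.1 hφ'
  have h2 := arg_add_cexp_eq_sub 1 φ one_pos hmem.1 hφ'
  simp only [ofReal_one, one_mul] at h2 ⊢
  have h3 : arg (r + cexp (φ * I)) =
      2 * arg (1 + cexp (φ * I)) - arg (1 + r * cexp (φ * I)) := by linarith
  rw [h3]
  push_cast
  ring

/-- The density `f_t` of the measure `ν_t`. -/
noncomputable def nuDensity (t x : ℝ) : ℝ :=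
  if (Real.sqrt t - 1) ^ 2 < x ∧ x < (Real.sqrt t + 1) ^ 2 then
    (1 / Real.pi) *
      (Real.pi / 2 - Real.arctan ((x + t - 1) / Real.sqrt (4 * x * t - (x + t - 1) ^ 2)))
  else if t < 1 ∧ 0 ≤ x ∧ x ≤ (1 - Real.sqrt t) ^ 2 then 1 else 0

theorem nuDensity_nonneg (t x : ℝ) : 0 ≤ nuDensity t x := by
  unfold nuDensity
  split_ifs
  · have := Real.arctan_lt_pi_div_two ((x + t - 1) / Real.sqrt (4 * x * t - (x + t - 1) ^ 2))
    have := Real.pi_pos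
    exact mul_nonneg (by positivity) (by linarith)
  · exact zero_le_one
  · exact le_rfl

theorem nuDensity_le_one (t x : ℝ) : nuDensity t x ≤ 1 := by
  unfold nuDensity
  split_ifs
  · have := Real.neg_pi_div_two_lt_arctan ((x + t - 1) / Real.sqrt (4 * x * t - (x + t - 1) ^ 2))
    have := Real.pi_pos
    rw [one_div, inv_mul_le_iff₀ this]
    linarith
  · exact le_rfl
  · exact zero_le_one

theorem measurable_nuDensity (t : ℝ) : Measurable (nuDensity t) := by
  unfold nuDensity
  refine Measurable.ite measurableSet_Ioo (by fun_prop)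
    (Measurable.ite ?_ (by fun_prop) (by fun_prop))
  exact (MeasurableSet.const _).inter measurableSet_Icc

open Complex in
theorem nuDensity_eq_arg {r φ : ℝ} (hr : 0 < r) (h0 : 0 < φ) (hπ : φ < Real.pi) :
    nuDensity (r ^ 2) (1 + r ^ 2 + 2 * r * Real.cos φ) =
      (1 / Real.pi) * arg (r + cexp (φ * I)) := by
  have hs := Real.sin_pos_of_pos_of_lt_pi h0 hπ
  have hc := Real.sin_sq_add_cos_sq φ
  have hz : 0 < ((r : ℂ) + cexp (φ * I)).im := by simpa [exp_ofReal_mul_I_im] using hs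
  have hc1 : Real.cos φ < 1 := by nlinarith
  have hc2 : -1 < Real.cos φ := by nlinarith
  rw [nuDensity, Real.sqrt_sq hr.le, if_pos ⟨by nlinarith, by nlinarith⟩,
    ← pi_div_two_sub_arctan_eq_arg hz]
  have h1 : 4 * (1 + r ^ 2 + 2 * r * Real.cos φ) * r ^ 2 -
      (1 + r ^ 2 + 2 * r * Real.cos φ + r ^ 2 - 1) ^ 2 = (2 * r * Real.sin φ) ^ 2 := by
    linear_combination 4 * r ^ 2 * (-hc)
  rw [h1, Real.sqrt_sq (by positivity)]
  congr 3
  simp only [add_re, add_im, ofReal_re, ofReal_im, exp_ofReal_mul_I_re, exp_ofReal_mul_I_im,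
    zero_add]
  field_simp
  ring

open Complex Set in
/-- The integral of `f_t` against a continuous function, the continuous part being parametrized
by the upper half circle. -/
theorem integral_nuDensity_mul {r : ℝ} (hr : 0 < r) {q : ℝ → ℂ} (hq : Continuous q) :
    ∫ x, (nuDensity (r ^ 2) x : ℂ) * q x =
      (1 / Real.pi) * (∫ φ in (0 : ℝ)..Real.pi, (arg (r + cexp (φ * I)) : ℂ) *
        (2 * r * Real.sin φ * q (1 + r ^ 2 + 2 * r * Real.cos φ))) +
      if r < 1 then ∫ x in (0 : ℝ)..(1 - r) ^ 2, q x else 0 := by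
  set A : Set ℝ := Ioo ((r - 1) ^ 2) ((r + 1) ^ 2) with hA
  set B : Set ℝ := {x | r < 1 ∧ x ∈ Icc 0 ((1 - r) ^ 2)} with hB
  have hBm : MeasurableSet B := (MeasurableSet.const _).inter measurableSet_Icc
  have hrt : r ^ 2 < 1 ↔ r < 1 := by rw [sq_lt_one_iff₀ hr.le]
  have hsplit : ∀ x, (nuDensity (r ^ 2) x : ℂ) * q x =
      A.indicator (fun x => (nuDensity (r ^ 2) x : ℂ) * q x) x + B.indicator q x := by
    intro x
    by_cases hxA : x ∈ A
    · have hxB : x ∉ B := fun h => by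
        have h1 := hxA.1
        have h2 := h.2.2
        nlinarith
      simp [hxA, hxB]
    · have hxA' : ¬ ((r - 1) ^ 2 < x ∧ x < (r + 1) ^ 2) := hxA
      rw [indicator_of_notMem hxA, zero_add]
      rw [nuDensity, Real.sqrt_sq hr.le, if_neg hxA']
      simp only [hrt]
      by_cases hxB : x ∈ B
      · rw [indicator_of_mem hxB, if_pos ⟨hxB.1, hxB.2.1, hxB.2.2⟩]; simp
      · rw [indicator_of_notMem hxB, if_neg fun h => hxB ⟨h.1, h.2.1, h.2.2⟩]; simp
  have hqA : IntegrableOn q A :=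
    (hq.continuousOn.integrableOn_Icc (a := (r - 1) ^ 2) (b := (r + 1) ^ 2)).mono_set
      Ioo_subset_Icc_self
  have hqB : IntegrableOn q B :=
    (hq.continuousOn.integrableOn_Icc (a := 0) (b := (1 - r) ^ 2)).mono_set fun x hx => hx.2
  have hfA : IntegrableOn (fun x => (nuDensity (r ^ 2) x : ℂ) * q x) A := by
    refine Integrable.bdd_mul (c := 1) hqA ?_ (Filter.Eventually.of_forall fun x => ?_)
    · exact (measurable_ofReal.comp (measurable_nuDensity _)).aestronglyMeasurable
    · rw [norm_real, Real.norm_of_nonneg (nuDensity_nonneg _ _)]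
      exact nuDensity_le_one _ _
  have himage : A = (fun φ => 1 + r ^ 2 + 2 * r * Real.cos φ) '' Ioo 0 Real.pi := by
    ext x
    constructor
    · rintro ⟨h1, h2⟩
      have h3 : -1 < (x - 1 - r ^ 2) / (2 * r) := by rw [lt_div_iff₀ (by positivity)]; nlinarith
      have h4 : (x - 1 - r ^ 2) / (2 * r) < 1 := by rw [div_lt_iff₀ (by positivity)]; nlinarith
      refine ⟨Real.arccos ((x - 1 - r ^ 2) / (2 * r)),
        ⟨Real.arccos_pos.2 h4, Real.arccos_lt_pi.2 h3⟩, ?_⟩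
      simp only [Real.cos_arccos h3.le h4.le]
      field_simp
      ring
    · rintro ⟨φ, ⟨h1, h2⟩, rfl⟩
      have hs := Real.sin_pos_of_pos_of_lt_pi h1 h2
      have hc := Real.sin_sq_add_cos_sq φ
      have hc1 : Real.cos φ < 1 := by nlinarith
      have hc2 : -1 < Real.cos φ := by nlinarith
      constructor <;> dsimp only <;> nlinarith
  have hinj : InjOn (fun φ => 1 + r ^ 2 + 2 * r * Real.cos φ) (Ioo 0 Real.pi) := by
    intro x hx y hy hxy
    refine Real.injOn_cos (Ioo_subset_Icc_self hx) (Ioo_subset_Icc_self hy) ?_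
    have : 2 * r * Real.cos x = 2 * r * Real.cos y := by simpa using hxy
    exact mul_left_cancel₀ (by positivity) this
  have hderiv : ∀ φ ∈ Ioo 0 Real.pi, HasDerivWithinAt (fun φ => 1 + r ^ 2 + 2 * r * Real.cos φ)
      (2 * r * -Real.sin φ) (Ioo 0 Real.pi) φ := fun φ _ =>
    (((Real.hasDerivAt_cos φ).const_mul (2 * r)).const_add (1 + r ^ 2)).hasDerivWithinAt
  have hIA : ∫ x in A, (nuDensity (r ^ 2) x : ℂ) * q x =
      (1 / Real.pi) * (∫ φ in (0 : ℝ)..Real.pi, (arg (r + cexp (φ * I)) : ℂ) *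
        (2 * r * Real.sin φ * q (1 + r ^ 2 + 2 * r * Real.cos φ))) := by
    rw [himage, integral_image_eq_integral_abs_deriv_smul measurableSet_Ioo hderiv hinj,
      intervalIntegral.integral_of_le Real.pi_pos.le, integral_Ioc_eq_integral_Ioo,
      ← integral_const_mul]
    refine setIntegral_congr_fun measurableSet_Ioo fun φ hφ => ?_
    have hs := Real.sin_pos_of_pos_of_lt_pi hφ.1 hφ.2
    have habs : |2 * r * -Real.sin φ| = 2 * r * Real.sin φ := by
      rw [mul_neg, abs_neg, abs_of_pos (by positivity)]
    simp only [habs, nuDensity_eq_arg hr hφ.1 hφ.2, real_smul]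
    push_cast
    ring
  have hIB : ∫ x in B, q x = if r < 1 then ∫ x in (0 : ℝ)..(1 - r) ^ 2, q x else 0 := by
    split_ifs with h
    · have : B = Icc 0 ((1 - r) ^ 2) := by ext x; simp [hB, h]
      rw [this, integral_Icc_eq_integral_Ioc, intervalIntegral.integral_of_le (sq_nonneg _)]
    · have : B = ∅ := by ext x; simp [hB, h]
      simp [this]
  rw [integral_congr_ae (Filter.Eventually.of_forall hsplit),
    integral_add (hfA.integrable_indicator measurableSet_Ioo) (hqB.integrable_indicator hBm),
    integral_indicator measurableSet_Ioo, integral_indicator hBm, hIA, hIB]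

open Complex in
theorem integral_nuDensity {r : ℝ} (hr : 0 < r) : ∫ x, nuDensity (r ^ 2) x = 1 := by
  have hπ : (Real.pi : ℂ) ≠ 0 := by exact_mod_cast Real.pi_ne_zero
  have h := integral_nuDensity_mul hr (q := fun _ => 1) continuous_const
  have hker : ∀ φ : ℝ, (2 * r * Real.sin φ * 1 : ℂ) =
      r * ((cexp (φ * I) - cexp (-(φ * I))) / I) := by
    intro φ
    rw [ofReal_sin, Complex.sin, div_I]
    ring_nf
  have hK : Continuous fun φ : ℝ => (r : ℂ) * ((cexp (φ * I) - cexp (-(φ * I))) / I) := by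
    fun_prop
  simp only [hker, mul_one] at h
  have hval : ∀ s : ℝ, 0 ≤ s → s ≤ 1 →
      ∫ φ in (0 : ℝ)..Real.pi, (arg (1 + s * cexp (φ * I)) : ℂ) *
        (r * ((cexp (φ * I) - cexp (-(φ * I))) / I)) = r * (Real.pi * s) := by
    intro s hs0 hs
    rw [← integral_arg_mul_sin hs0 hs, ← intervalIntegral.integral_const_mul]
    congr 1 with φ
    ring
  rw [integral_complex_ofReal] at h
  rw [← ofReal_inj, h]
  rcases le_or_gt 1 r with h1 | h1
  · have hrc : (r : ℂ) ≠ 0 := by exact_mod_cast hr.ne'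
    rw [integral_arg_add_cexp_of_one_le h1, hval _ (by positivity) (inv_le_one_of_one_le₀ h1),
      if_neg h1.not_gt]
    push_cast
    field_simp
    ring
  · rw [integral_arg_add_cexp hr hK, hval 1 zero_le_one le_rfl, hval r hr.le h1.le, if_pos h1,
      intervalIntegral.integral_const, sub_zero, real_smul]
    push_cast
    field_simp
    ring

open Complex in
/-- Points off the real axis are parametrized by the unit disk through a Joukowski map. -/
theorem exists_norm_lt_one_joukowski {r : ℝ} (hr : 0 < r) {z : ℂ} (hz : z.im ≠ 0) :
    ∃ a : ℂ, a ≠ 0 ∧ ‖a‖ < 1 ∧ z = (1 + r * a) * (1 + r / a) := by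
  have hrc : (r : ℂ) ≠ 0 := by exact_mod_cast hr.ne'
  obtain ⟨a, ha⟩ := exists_quadratic_eq_zero (K := ℂ) hrc (b := 1 + (r : ℂ) ^ 2 - z) (c := r)
    (IsAlgClosed.exists_eq_mul_self _)
  have h0 : a ≠ 0 := by rintro rfl; simp [hrc] at ha
  have hza : z = (1 + r * a) * (1 + r / a) := by
    field_simp
    linear_combination -ha
  rcases lt_trichotomy ‖a‖ 1 with h | h | h
  · exact ⟨a, h0, h, hza⟩
  · refine absurd ?_ hz
    have hinv : a⁻¹ = (starRingEnd ℂ) a := by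
      rw [inv_def, normSq_eq_norm_sq, h]; simp
    have : z = ((1 + r ^ 2 + r * (2 * a.re) : ℝ) : ℂ) := by
      have h2 := add_conj a
      rw [hza, div_eq_mul_inv]
      have h3 : a * a⁻¹ = 1 := mul_inv_cancel₀ h0
      push_cast at h2 ⊢
      rw [← h2, ← hinv]
      linear_combination (r : ℂ) ^ 2 * h3
    rw [this, ofReal_im]
  · refine ⟨a⁻¹, inv_ne_zero h0, by rw [norm_inv]; exact inv_lt_one_of_one_lt₀ h, ?_⟩
    rw [hza]
    field_simp

open Complex in
theorem exp_integral_inv_sub {z : ℂ} (hz : z.im ≠ 0) (b : ℝ) :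
    cexp (∫ x in (0 : ℝ)..b, ((x : ℂ) - z)⁻¹) = (b - z) / (-z) := by
  have hsp : ∀ x : ℝ, (x : ℂ) - z ∈ slitPlane := fun x => by right; simpa using hz
  have hne : ∀ x : ℝ, (x : ℂ) - z ≠ 0 := fun x => slitPlane_ne_zero (hsp x)
  rw [intervalIntegral.integral_eq_sub_of_hasDerivAt (f := fun x : ℝ => log ((x : ℂ) - z))
    (fun x _ => ?_) ?_]
  · rw [exp_sub, exp_log (hne _), exp_log (hne _)]
    simp
  · exact (Continuous.inv₀ (by fun_prop) hne).intervalIntegrable _ _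
  · have h1 : HasDerivAt (fun x : ℝ => (x : ℂ) - z) 1 x :=
      (ofRealCLM.hasDerivAt).sub_const z
    simpa using h1.clog_real (hsp x)

open Complex in
theorem exp_stieltjes_nuDensity {r : ℝ} (hr : 0 < r) {z a : ℂ} (hz : z.im ≠ 0) (ha0 : a ≠ 0)
    (ha : ‖a‖ < 1) (hza : z = (1 + r * a) * (1 + r / a)) :
    cexp (∫ x : ℝ, (nuDensity (r ^ 2) x : ℂ) / ((x : ℂ) - z)) = r / (r + a) := by
  have hπ : (Real.pi : ℂ) ≠ 0 := by exact_mod_cast Real.pi_ne_zero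
  have hrc : (r : ℂ) ≠ 0 := by exact_mod_cast hr.ne'
  have hz0 : z ≠ 0 := by rintro rfl; simp at hz
  have hne : ∀ x : ℝ, (x : ℂ) - z ≠ 0 := fun x h => hz (by simpa using congrArg im h)
  have hra : (r : ℂ) + a ≠ 0 := by
    intro h
    refine hz0 ?_
    have : 1 + (r : ℂ) / a = 0 := by field_simp; linear_combination h
    rw [hza, this, mul_zero]
  have hra' : 1 + (r : ℂ) * a ≠ 0 := fun h => hz0 (by rw [hza, h, zero_mul])
  have hn1 : ∀ φ : ℝ, 1 - a * cexp (φ * I) ≠ 0 := fun φ =>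
    one_sub_mul_ne_zero ha (norm_exp_ofReal_mul_I φ).le
  have hn2 : ∀ φ : ℝ, 1 - a * cexp (-(φ * I)) ≠ 0 := fun φ =>
    one_sub_mul_ne_zero ha (by simpa using (norm_exp_ofReal_mul_I (-φ)).le)
  have h := integral_nuDensity_mul hr (q := fun x : ℝ => ((x : ℂ) - z)⁻¹)
    (Continuous.inv₀ (by fun_prop) hne)
  have hker : ∀ φ : ℝ, (2 * r * Real.sin φ *
      (((1 + r ^ 2 + 2 * r * Real.cos φ : ℝ) : ℂ) - z)⁻¹ : ℂ) =
      -(((1 - a * cexp (φ * I))⁻¹ - (1 - a * cexp (-(φ * I)))⁻¹) / I) := by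
    intro φ
    have hd : (((1 + r ^ 2 + 2 * r * Real.cos φ : ℝ) : ℂ) - z) =
        -(r / a) * ((1 - a * cexp (φ * I)) * (1 - a * cexp (-(φ * I)))) := by
      have he : cexp (φ * I) * cexp (-(φ * I)) = 1 := by rw [← exp_add]; simp
      rw [hza]
      push_cast
      rw [Complex.cos, neg_mul]
      field_simp
      linear_combination (r : ℂ) * a ^ 2 * he
    rw [hd, ofReal_sin, Complex.sin, div_I, inv_sub_inv (hn1 φ) (hn2 φ), neg_mul (φ : ℂ) I]
    have h1 := hn1 φ
    have h2 := hn2 φ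
    field_simp
    ring
  have hK : Continuous fun φ : ℝ =>
      -(((1 - a * cexp (φ * I))⁻¹ - (1 - a * cexp (-(φ * I)))⁻¹) / I) :=
    (Continuous.div_const (.sub (.inv₀ (by fun_prop) hn1) (.inv₀ (by fun_prop) hn2)) _).neg
  have hval : ∀ s : ℝ, 0 ≤ s → s ≤ 1 →
      ∫ φ in (0 : ℝ)..Real.pi, (arg (1 + s * cexp (φ * I)) : ℂ) *
        -(((1 - a * cexp (φ * I))⁻¹ - (1 - a * cexp (-(φ * I)))⁻¹) / I) =
      -(Real.pi * log (1 + s * a)) := by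
    intro s hs0 hs
    rw [← integral_arg_mul_cauchy_kernel hs0 hs ha, ← intervalIntegral.integral_neg]
    congr 1 with φ
    ring
  have hn3 : ∀ s : ℝ, 0 ≤ s → s ≤ 1 → 1 + (s : ℂ) * a ≠ 0 := by
    intro s hs0 hs h
    have h1 : ‖(s : ℂ) * a‖ = 1 := by rw [eq_neg_of_add_eq_zero_right h]; simp
    rw [norm_mul, norm_real, Real.norm_of_nonneg hs0] at h1
    nlinarith [norm_nonneg a]
  simp only [hker] at h
  simp only [div_eq_mul_inv]
  rw [h]
  rcases le_or_gt 1 r with h1 | h1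
  · have hs0 : 0 ≤ r⁻¹ := by positivity
    have hs1 := inv_le_one_of_one_le₀ h1
    rw [integral_arg_add_cexp_of_one_le h1, hval _ hs0 hs1, if_neg h1.not_gt, add_zero,
      show (1 / Real.pi : ℂ) * -(Real.pi * log (1 + (r⁻¹ : ℝ) * a)) =
        -log (1 + (r⁻¹ : ℝ) * a) by field_simp,
      exp_neg, exp_log (hn3 _ hs0 hs1)]
    push_cast
    field_simp
  · have hn := hn3 1 zero_le_one le_rfl
    rw [integral_arg_add_cexp hr hK, hval 1 zero_le_one le_rfl, hval r hr.le h1.le, if_pos h1,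
      show (1 / Real.pi : ℂ) * (2 * -(Real.pi * log (1 + (1 : ℝ) * a)) -
        -(Real.pi * log (1 + r * a))) =
        log (1 + r * a) - (log (1 + (1 : ℝ) * a) + log (1 + (1 : ℝ) * a)) by field_simp; ring,
      exp_add, exp_sub, exp_add, exp_log hn, exp_log hra', exp_integral_inv_sub hz]
    have hB : (((1 - r) ^ 2 : ℝ) : ℂ) - z = -(r / a) * (1 + (1 : ℝ) * a) ^ 2 := by
      rw [hza]
      push_cast
      field_simp
      ring
    have hz' : -z = -((1 + r * a) * (r + a) / a) := by
      rw [hza]; field_simp; ring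
    rw [hB, hz']
    simp only [ofReal_one, one_mul] at hn ⊢
    field_simp

/-- The measure `ν_t` of the paper: its density `f_t` satisfies `0 ≤ f_t ≤ 1`,
`∫ f_t = 1`, and its Stieltjes transform `m` solves
`z e^{2m(z)} + (1 − t − z) e^{m(z)} + t = 0` on `ℂ ∖ ℝ`. -/
theorem stmt12 (t : ℝ) (ht : 0 < t) (f : ℝ → ℝ)
    (hf : ∀ x : ℝ, f x =
      if (Real.sqrt t - 1) ^ 2 < x ∧ x < (Real.sqrt t + 1) ^ 2 then
        (1 / Real.pi) *
          (Real.pi / 2 - Real.arctan ((x + t - 1) / Real.sqrt (4 * x * t - (x + t - 1) ^ 2)))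
      else if t < 1 ∧ 0 ≤ x ∧ x ≤ (1 - Real.sqrt t) ^ 2 then 1 else 0) :
    (∀ x : ℝ, 0 ≤ f x ∧ f x ≤ 1) ∧
    (∫ x : ℝ, f x = 1) ∧
    (∀ z : ℂ, z.im ≠ 0 →
      z * Complex.exp (2 * ∫ x : ℝ, (f x : ℂ) / ((x : ℂ) - z)) +
        (1 - (t : ℂ) - z) * Complex.exp (∫ x : ℝ, (f x : ℂ) / ((x : ℂ) - z)) + (t : ℂ) = 0) := by
  obtain rfl : f = nuDensity t := funext hf
  have hr := Real.sqrt_pos.2 ht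
  have hrt := Real.sq_sqrt ht.le
  refine ⟨fun x => ⟨nuDensity_nonneg t x, nuDensity_le_one t x⟩, ?_, fun z hz => ?_⟩
  · rw [← hrt]
    exact integral_nuDensity hr
  · obtain ⟨a, ha0, ha, hza⟩ := exists_norm_lt_one_joukowski hr hz
    have hexp := exp_stieltjes_nuDensity hr hz ha0 ha hza
    have hz0 : z ≠ 0 := by rintro rfl; simp at hz
    have hra : (Real.sqrt t : ℂ) + a ≠ 0 := by
      intro h
      refine hz0 ?_
      have : 1 + (Real.sqrt t : ℂ) / a = 0 := by field_simp; linear_combination h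
      rw [hza, this, mul_zero]
    have htc : (t : ℂ) = (Real.sqrt t : ℂ) ^ 2 := by exact_mod_cast hrt.symm
    rw [hrt] at hexp
    rw [two_mul, Complex.exp_add, hexp, htc, hza]
    field_simp
    ring
end

section
/- Fix a real number θ > 0, an integer n ≥ 1, and a real number r > 0. For a Young diagram λ = (λ_1 ≥ λ_2 ≥ …) with at most n nonzero rows, and a box □ = (i,j) ∈ λ (meaning 1 ≤ i, 1 ≤ j ≤ λ_i), write a_□ = λ_i − j, l_□ = λ'_j − i, a'_□ = j − 1, l'_□ = i − 1, where λ' is the transposed diagram. Then ∑_{λ} r^{|λ|} · ∏_{□ ∈ λ} (θn + a'_□ − θ·l'_□) / ((a_□ + θ·l_□ + θ)(a_□ + θ·l_□ + 1)) = e^{rn}, where the sum is over all Young diagrams λ with at most n nonzero rows and |λ| denotes the number of boxes of λ. -/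
open Polynomial in
theorem coeff_X_sq_mul_prod_X_sub_C {ι : Type*} (s : Finset ι) (a : ι → ℝ) :
    (X ^ 2 * ∏ j ∈ s, (X - C (a j))).coeff (s.card + 2) = 1 ∧
    (X ^ 2 * ∏ j ∈ s, (X - C (a j))).coeff (s.card + 1) = -∑ j ∈ s, a j ∧
    (X ^ 2 * ∏ j ∈ s, (X - C (a j))).coeff s.card =
      ((∑ j ∈ s, a j) ^ 2 - ∑ j ∈ s, a j ^ 2) / 2 := by
  classical
  induction s using Finset.induction_on with
  | empty => simp [coeff_X_pow]
  | insert i s hi ih =>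
    obtain ⟨h₂, h₁, h₀⟩ := ih
    have key : X ^ 2 * ∏ j ∈ insert i s, (X - C (a j)) =
        (X ^ 2 * ∏ j ∈ s, (X - C (a j))) * (X - C (a i)) := by
      rw [Finset.prod_insert hi]; ring
    have hdeg : (X ^ 2 * ∏ j ∈ s, (X - C (a j))).coeff (s.card + 2 + 1) = 0 := by
      apply coeff_eq_zero_of_natDegree_lt
      have : (X ^ 2 * ∏ j ∈ s, (X - C (a j))).natDegree ≤ 2 + s.card := by
        refine natDegree_mul_le.trans (add_le_add (by simp) ?_)
        rw [natDegree_prod_of_monic _ _ (fun j _ => monic_X_sub_C _)]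
        simp
      omega
    rw [key, Finset.card_insert_of_notMem hi, Finset.sum_insert hi, Finset.sum_insert hi]
    refine ⟨?_, ?_, ?_⟩
    · rw [show s.card + 1 + 2 = s.card + 2 + 1 by ring, mul_sub, coeff_sub, coeff_mul_X,
        coeff_mul_C, hdeg, h₂]; ring
    · rw [mul_sub, coeff_sub, coeff_mul_X, coeff_mul_C, h₁, h₂]; ring
    · rw [mul_sub, coeff_sub, coeff_mul_X, coeff_mul_C, h₀, h₁]; ring

open Polynomial in
theorem sum_prod_shift_div {ι : Type*} [DecidableEq ι] (s : Finset ι) (y : ι → ℝ)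
    (hy : Set.InjOn y s) (t : ℝ) (ht : t ≠ 0) :
    ∑ i ∈ s, ∏ j ∈ s.erase i, (y i - y j + t) / (y i - y j) = s.card ∧
    ∑ i ∈ s, y i * ∏ j ∈ s.erase i, (y i - y j + t) / (y i - y j) =
      ∑ i ∈ s, y i + t * (s.card * (s.card - 1) / 2) := by
  rcases s.eq_empty_or_nonempty with rfl | hs
  · simp
  obtain ⟨m, hm⟩ : ∃ m, s.card = m + 1 := ⟨s.card - 1, by have := hs.card_pos; omega⟩
  set Q : ℝ[X] := ∏ j ∈ s, (X - C (y j)) with hQ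
  set R : ℝ[X] := ∏ j ∈ s, (X - C (y j - t)) with hR
  obtain ⟨q₂, q₁, q₀⟩ := coeff_X_sq_mul_prod_X_sub_C s y
  obtain ⟨r₂, r₁, r₀⟩ := coeff_X_sq_mul_prod_X_sub_C s (fun j => y j - t)
  rw [← hQ] at q₂ q₁ q₀
  rw [← hR] at r₂ r₁ r₀
  have hQd : Q.natDegree = s.card := by
    rw [hQ, natDegree_prod_of_monic _ _ (fun j _ => monic_X_sub_C _)]; simp
  have hRd : R.natDegree = s.card := by
    rw [hR, natDegree_prod_of_monic _ _ (fun j _ => monic_X_sub_C _)]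
    simp only [natDegree_X_sub_C, Finset.sum_const, smul_eq_mul, mul_one]
  have hQe : ∀ i ∈ s, Q.eval (y i) = 0 := fun i hi => by
    rw [hQ, eval_prod]; exact Finset.prod_eq_zero hi (by simp)
  have hRe : ∀ i ∈ s, R.eval (y i) = t * ∏ j ∈ s.erase i, (y i - y j + t) := fun i hi => by
    rw [hR, eval_prod, ← Finset.mul_prod_erase _ _ hi]
    simp [sub_add]
  have c₁ : R.coeff m - Q.coeff m = s.card * t := by
    rw [coeff_X_pow_mul', if_pos (by omega), show s.card + 1 - 2 = m by omega] at r₁ q₁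
    rw [r₁, q₁]; simp [Finset.sum_sub_distrib]
  have c₂ : R.coeff s.card = 1 ∧ Q.coeff s.card = 1 := by
    rw [coeff_X_pow_mul] at r₂ q₂
    exact ⟨r₂, q₂⟩
  have hP : ∀ k, s.card ≤ k → (R - Q).coeff k = 0 := fun k hk => by
    rcases hk.eq_or_lt with rfl | hk
    · rw [coeff_sub, c₂.1, c₂.2, sub_self]
    · rw [coeff_sub, coeff_eq_zero_of_natDegree_lt (hRd.trans_lt hk),
        coeff_eq_zero_of_natDegree_lt (hQd.trans_lt hk), sub_self]
  have hPd : (R - Q).degree < s.card := (degree_lt_iff_coeff_zero _ _).2 hP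
  constructor
  · have h := Lagrange.coeff_eq_sum hy hPd
    rw [hm, Nat.add_sub_cancel, coeff_sub, c₁, hm] at h
    have h' : t * ∑ i ∈ s, ∏ j ∈ s.erase i, (y i - y j + t) / (y i - y j) = s.card * t := by
      rw [hm, h, Finset.mul_sum]
      refine Finset.sum_congr rfl fun i hi => ?_
      rw [eval_sub, hQe i hi, hRe i hi, sub_zero, Finset.prod_div_distrib, mul_div_assoc]
    rw [mul_comm] at h'
    exact mul_right_cancel₀ ht h'
  · set T : ℝ[X] := X * (R - Q) - C (s.card * t) * Q with hT
    have hTd : T.degree < s.card := by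
      refine (degree_lt_iff_coeff_zero _ _).2 fun k hk => ?_
      obtain ⟨k, rfl⟩ : ∃ l, k = l + 1 := ⟨k - 1, by omega⟩
      rw [hT, coeff_sub, coeff_X_mul, coeff_C_mul]
      rcases hk.eq_or_lt with hk | hk
      · rw [← hk, c₂.2, coeff_sub, show k = m by omega, c₁]; ring
      · rw [hP k (by omega), coeff_eq_zero_of_natDegree_lt (hQd.trans_lt hk)]; ring
    have h := Lagrange.coeff_eq_sum hy hTd
    have hc : T.coeff m = t * (∑ i ∈ s, y i + t * (s.card * (s.card - 1) / 2)) := by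
      have e : (X ^ 2 * T).coeff (m + 2) = T.coeff m := coeff_X_pow_mul _ _ _
      rw [← e, hT, show X ^ 2 * (X * (R - Q) - C (s.card * t) * Q) =
        (X ^ 2 * R - X ^ 2 * Q) * X - C (s.card * t) * (X ^ 2 * Q) by ring, coeff_sub,
        coeff_C_mul, coeff_mul_X, show m + 2 = s.card + 1 by omega,
        show m + 1 = s.card by omega, coeff_sub, r₀, q₀, q₁]
      simp only [Finset.sum_sub_distrib, sub_sq, Finset.sum_add_distrib, Finset.sum_const,
        nsmul_eq_mul, ← Finset.sum_mul, ← Finset.mul_sum]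
      ring
    rw [show s.card - 1 = m by omega, hc] at h
    refine mul_left_cancel₀ ht (Eq.trans ?_ h.symm)
    rw [Finset.mul_sum]
    refine Finset.sum_congr rfl fun i hi => ?_
    rw [hT, eval_sub, eval_mul, eval_mul, eval_sub, hQe i hi, hRe i hi, eval_X, sub_zero, mul_zero,
      sub_zero, Finset.prod_div_distrib]
    ring

/-- Two-body factor of the weight of a Young diagram, as a function of the distance between two
shifted rows. -/
noncomputable def gammaInteraction (θ d : ℝ) : ℝ :=
  Real.Gamma (d + θ) * Real.Gamma (d + 1) / (Real.Gamma d * Real.Gamma (d + 1 - θ))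

theorem gammaInteraction_mul {θ d : ℝ} (hθ : 0 < θ) (hd : 0 < d) (hd' : 0 < d + 1 - θ) :
    gammaInteraction θ d * ((d + θ) / d) =
      gammaInteraction θ (d + 1) * ((d + 1 - θ) / (d + 1)) := by
  have h₁ := Real.Gamma_add_one (s := d + θ) (by positivity)
  have h₂ := Real.Gamma_add_one (s := d + 1) (by positivity)
  have h₃ := Real.Gamma_add_one (s := d) (by positivity)
  have h₄ := Real.Gamma_add_one (s := d + 1 - θ) hd'.ne'
  have p₁ := Real.Gamma_pos_of_pos hd
  have p₂ := Real.Gamma_pos_of_pos hd'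
  unfold gammaInteraction
  rw [show d + 1 + θ = d + θ + 1 by ring, show d + 1 + 1 - θ = d + 1 - θ + 1 by ring,
    h₁, h₂, h₃, h₄]
  have := hd'.ne'
  field_simp

/-- The shifted row lengths `λ_i + θ (n - 1 - i)`. -/
def shiftedRow (θ : ℝ) (n : ℕ) (f : ℕ → ℕ) (i : ℕ) : ℝ := f i + θ * (n - 1 - i)

theorem theta_le_shiftedRow_sub {θ : ℝ} (hθ : 0 < θ) (n : ℕ) {f : ℕ → ℕ} (hf : Antitone f)
    {i j : ℕ} (hij : i < j) : θ ≤ shiftedRow θ n f i - shiftedRow θ n f j := by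
  have h₁ : (f j : ℝ) ≤ f i := by exact_mod_cast hf hij.le
  have h₂ : (i : ℝ) + 1 ≤ j := by exact_mod_cast hij
  unfold shiftedRow
  nlinarith

theorem shiftedRow_injective {θ : ℝ} (hθ : 0 < θ) (n : ℕ) {f : ℕ → ℕ} (hf : Antitone f) :
    Function.Injective (shiftedRow θ n f) :=
  StrictAnti.injective fun _ _ hij => by linarith [theta_le_shiftedRow_sub hθ n hf hij]

theorem prod_prod_eq_mul_erase {ι M : Type*} [DecidableEq ι] [CommMonoid M] {s : Finset ι} {i : ι}
    (hi : i ∈ s) (F : ι → ι → M) :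
    ∏ a ∈ s, ∏ b ∈ s, F a b =
      F i i * (∏ b ∈ s.erase i, (F i b * F b i)) * ∏ a ∈ s.erase i, ∏ b ∈ s.erase i, F a b := by
  rw [← Finset.mul_prod_erase s _ hi, ← Finset.mul_prod_erase s _ hi, Finset.prod_mul_distrib,
    Finset.prod_congr rfl fun a _ => (Finset.mul_prod_erase s (F a) hi).symm,
    Finset.prod_mul_distrib]
  simp only [mul_assoc]

/-- The weight of the diagram with row lengths `f`, up to a normalization constant. -/
noncomputable def gammaWeight (θ : ℝ) (n : ℕ) (f : ℕ → ℕ) : ℝ :=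
  (∏ i ∈ Finset.range n, (Real.Gamma (shiftedRow θ n f i + 1))⁻¹) *
    ∏ i ∈ Finset.range n, ∏ k ∈ Finset.range n,
      if i < k then gammaInteraction θ (shiftedRow θ n f i - shiftedRow θ n f k) else 1

/-- Rate at which row `i` of the diagram grows. -/
noncomputable def upRate (θ : ℝ) (n : ℕ) (f : ℕ → ℕ) (i : ℕ) : ℝ :=
  ∏ j ∈ (Finset.range n).erase i, (shiftedRow θ n f i - shiftedRow θ n f j + θ) /
    (shiftedRow θ n f i - shiftedRow θ n f j)

/-- Rate at which row `i` of the diagram shrinks in the reversed dynamics. -/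
noncomputable def downRate (θ : ℝ) (n : ℕ) (f : ℕ → ℕ) (i : ℕ) : ℝ :=
  shiftedRow θ n f i *
    ∏ j ∈ (Finset.range n).erase i, (shiftedRow θ n f i - shiftedRow θ n f j + -θ) /
      (shiftedRow θ n f i - shiftedRow θ n f j)

theorem gammaWeight_mul_upRate {θ : ℝ} (hθ : 0 < θ) {n : ℕ} {f : ℕ → ℕ} {i : ℕ} (hi : i < n)
    (hf : Antitone f) (hf' : Antitone (f + Pi.single i 1)) :
    gammaWeight θ n f * upRate θ n f i =
      gammaWeight θ n (f + Pi.single i 1) * downRate θ n (f + Pi.single i 1) i := by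
  set g := f + Pi.single i 1 with hg
  have hgi : shiftedRow θ n g i = shiftedRow θ n f i + 1 := by
    simp [shiftedRow, hg]; ring
  have hgj : ∀ j, j ≠ i → shiftedRow θ n g j = shiftedRow θ n f j := fun j hj => by
    simp [shiftedRow, hg, hj]
  have hlast : 0 < shiftedRow θ n f i + 1 := by
    have : (i : ℝ) + 1 ≤ n := by exact_mod_cast hi
    unfold shiftedRow
    have : 0 ≤ θ * (n - 1 - i) := mul_nonneg hθ.le (by linarith)
    positivity
  have hpair : ∀ b ∈ (Finset.range n).erase i,
      ((if i < b then gammaInteraction θ (shiftedRow θ n f i - shiftedRow θ n f b) else 1) *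
        (if b < i then gammaInteraction θ (shiftedRow θ n f b - shiftedRow θ n f i) else 1)) *
        ((shiftedRow θ n f i - shiftedRow θ n f b + θ) /
          (shiftedRow θ n f i - shiftedRow θ n f b)) =
      ((if i < b then gammaInteraction θ (shiftedRow θ n g i - shiftedRow θ n g b) else 1) *
        (if b < i then gammaInteraction θ (shiftedRow θ n g b - shiftedRow θ n g i) else 1)) *
        ((shiftedRow θ n g i - shiftedRow θ n g b + -θ) /
          (shiftedRow θ n g i - shiftedRow θ n g b)) := by
    intro b hb
    have hbi := Finset.ne_of_mem_erase hb
    rcases lt_or_gt_of_ne hbi with h | h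
    · have hd := theta_le_shiftedRow_sub hθ n hf' h
      rw [hgj b hbi, hgi] at hd
      have key := gammaInteraction_mul hθ (hθ.trans_le hd) (by linarith)
      rw [if_neg h.not_gt, if_neg h.not_gt, if_pos h, if_pos h, hgj b hbi, hgi, one_mul, one_mul]
      set x := shiftedRow θ n f i
      set z := shiftedRow θ n f b
      rw [show z - (x + 1) + 1 = z - x by ring] at key
      rw [← neg_div_neg_eq, show -(x - z + θ) = z - x - θ by ring, neg_sub, ← key,
        ← neg_div_neg_eq]
      congr 2 <;> ring
    · have hd := theta_le_shiftedRow_sub hθ n hf h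
      have key := gammaInteraction_mul hθ (hθ.trans_le hd) (by linarith)
      rw [if_neg h.not_gt, if_neg h.not_gt, if_pos h, if_pos h, hgj b hbi, hgi, mul_one, mul_one,
        key]
      ring_nf
  have hrest : ∏ a ∈ (Finset.range n).erase i, ∏ b ∈ (Finset.range n).erase i,
      (if a < b then gammaInteraction θ (shiftedRow θ n g a - shiftedRow θ n g b) else 1) =
      ∏ a ∈ (Finset.range n).erase i, ∏ b ∈ (Finset.range n).erase i,
      (if a < b then gammaInteraction θ (shiftedRow θ n f a - shiftedRow θ n f b) else 1) :=
    Finset.prod_congr rfl fun a ha => Finset.prod_congr rfl fun b hb => by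
      rw [hgj a (Finset.ne_of_mem_erase ha), hgj b (Finset.ne_of_mem_erase hb)]
  have hone : ∏ a ∈ (Finset.range n).erase i, (Real.Gamma (shiftedRow θ n g a + 1))⁻¹ =
      ∏ a ∈ (Finset.range n).erase i, (Real.Gamma (shiftedRow θ n f a + 1))⁻¹ :=
    Finset.prod_congr rfl fun a ha => by rw [hgj a (Finset.ne_of_mem_erase ha)]
  have hprod := Finset.prod_congr rfl hpair
  simp only [Finset.prod_mul_distrib] at hprod
  have hin : i ∈ Finset.range n := Finset.mem_range.2 hi
  have hΓ := Real.Gamma_add_one hlast.ne'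
  have hΓ' : (Real.Gamma (shiftedRow θ n f i + 1))⁻¹ =
      (Real.Gamma (shiftedRow θ n g i + 1))⁻¹ * shiftedRow θ n g i := by
    rw [hgi, hΓ]
    have := (Real.Gamma_pos_of_pos hlast).ne'
    field_simp
  unfold gammaWeight upRate downRate
  rw [prod_prod_eq_mul_erase hin, prod_prod_eq_mul_erase hin, hrest,
    ← Finset.mul_prod_erase _ _ hin, ← Finset.mul_prod_erase _ _ hin, hone, hΓ',
    if_neg (lt_irrefl i), if_neg (lt_irrefl i)]
  simp only [Finset.prod_mul_distrib]
  linear_combination ((Real.Gamma (shiftedRow θ n g i + 1))⁻¹ * shiftedRow θ n g i *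
    (∏ a ∈ (Finset.range n).erase i, (Real.Gamma (shiftedRow θ n f a + 1))⁻¹) *
    ∏ a ∈ (Finset.range n).erase i, ∏ b ∈ (Finset.range n).erase i,
      (if a < b then gammaInteraction θ (shiftedRow θ n f a - shiftedRow θ n f b) else 1)) * hprod

theorem upRate_eq_zero {θ : ℝ} {n : ℕ} {f : ℕ → ℕ} {i : ℕ} (hi : i + 1 < n)
    (h : f i = f (i + 1)) : upRate θ n f (i + 1) = 0 := by
  refine Finset.prod_eq_zero (i := i) (by simp; omega) ?_
  rw [div_eq_zero_iff]
  left
  simp only [shiftedRow, h]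
  push_cast
  ring

theorem downRate_eq_zero {θ : ℝ} {n : ℕ} {f : ℕ → ℕ} {i : ℕ} (hi : i + 1 < n)
    (h : f i = f (i + 1)) : downRate θ n f i = 0 := by
  refine mul_eq_zero_of_right _ (Finset.prod_eq_zero (i := i + 1) (by simp; omega) ?_)
  rw [div_eq_zero_iff]
  left
  simp only [shiftedRow, h]
  push_cast
  ring

theorem downRate_eq_zero_of_row_eq_zero {θ : ℝ} {n : ℕ} {f : ℕ → ℕ} {i : ℕ} (hf : Antitone f)
    (hi : i < n) (h : f i = 0) : downRate θ n f i = 0 := by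
  rcases (Nat.succ_le_of_lt hi).eq_or_lt with hn | hn
  · have : shiftedRow θ n f i = 0 := by
      simp [shiftedRow, h, ← hn]
    simp [downRate, this]
  · exact downRate_eq_zero hn (by
      have := hf i.le_succ
      simp only [Nat.succ_eq_add_one] at this
      omega)

theorem sum_upRate {θ : ℝ} (hθ : 0 < θ) (n : ℕ) {f : ℕ → ℕ} (hf : Antitone f) :
    ∑ i ∈ Finset.range n, upRate θ n f i = n := by
  have h := (sum_prod_shift_div (Finset.range n) (shiftedRow θ n f)
    (shiftedRow_injective hθ n hf).injOn θ hθ.ne').1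
  rwa [Finset.card_range] at h

theorem sum_downRate {θ : ℝ} (hθ : 0 < θ) (n : ℕ) {f : ℕ → ℕ} (hf : Antitone f) :
    ∑ i ∈ Finset.range n, downRate θ n f i = ∑ i ∈ Finset.range n, f i := by
  have h := (sum_prod_shift_div (Finset.range n) (shiftedRow θ n f)
    (shiftedRow_injective hθ n hf).injOn (-θ) (neg_ne_zero.2 hθ.ne')).2
  have hs : ∀ m : ℕ, ∑ i ∈ Finset.range m, (i : ℝ) = m * (m - 1) / 2 := fun m => by
    induction m with
    | zero => simp
    | succ m ih => rw [Finset.sum_range_succ, ih]; push_cast; ring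
  unfold downRate
  rw [h]
  simp only [shiftedRow, Finset.sum_add_distrib, ← Finset.mul_sum, Finset.sum_sub_distrib, hs]
  simp
  ring

open Classical in
/-- The weight `gammaWeight`, extended by zero to sequences that are not nonincreasing. -/
noncomputable def diagramWeight (θ : ℝ) (n : ℕ) (f : ℕ → ℕ) : ℝ :=
  if Antitone f then gammaWeight θ n f else 0

theorem diagramWeight_mul_upRate {θ : ℝ} (hθ : 0 < θ) {n : ℕ} {f : ℕ → ℕ} {i : ℕ} (hi : i < n)
    (hf : ∀ j, f j ≠ 0 → j < n) :
    diagramWeight θ n f * upRate θ n f i =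
      diagramWeight θ n (f + Pi.single i 1) * downRate θ n (f + Pi.single i 1) i := by
  unfold diagramWeight
  split_ifs with h h' h'
  · exact gammaWeight_mul_upRate hθ hi h h'
  · rw [zero_mul]
    refine mul_eq_zero_of_right _ ?_
    by_contra hne
    refine h' (antitone_nat_of_succ_le fun j => ?_)
    have hj := h j.le_succ
    simp only [Nat.succ_eq_add_one] at hj
    rcases eq_or_ne i (j + 1) with rfl | hij
    · have : f j ≠ f (j + 1) := fun e => hne (upRate_eq_zero hi e)
      simp
      omega
    · simp only [Pi.add_apply, Pi.single_apply, if_neg hij.symm]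
      omega
  · rw [zero_mul, eq_comm]
    refine mul_eq_zero_of_right _ ?_
    by_contra hne
    refine h (antitone_nat_of_succ_le fun j => ?_)
    have hj := h' j.le_succ
    simp only [Nat.succ_eq_add_one, Pi.add_apply, Pi.single_apply] at hj
    rcases eq_or_ne i j with rfl | hij
    · by_contra hlt
      refine hne (downRate_eq_zero (hf _ (by omega)) ?_)
      simp
      simp at hj
      omega
    · rw [if_neg hij.symm] at hj
      omega
  · simp

theorem sum_diagramWeight_succ {θ : ℝ} (hθ : 0 < θ) (n k : ℕ) :
    (∑ f ∈ (Finset.range n).piAntidiag (k + 1), diagramWeight θ n f) * (k + 1 : ℕ) =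
      (∑ f ∈ (Finset.range n).piAntidiag k, diagramWeight θ n f) * n := by
  have hup : ∀ f ∈ (Finset.range n).piAntidiag k, diagramWeight θ n f * n =
      ∑ i ∈ Finset.range n, diagramWeight θ n f * upRate θ n f i := fun f _ => by
    by_cases h : Antitone f
    · rw [← Finset.mul_sum, sum_upRate hθ n h]
    · simp [diagramWeight, h]
  have hdown : ∀ f ∈ (Finset.range n).piAntidiag (k + 1), diagramWeight θ n f * (k + 1 : ℕ) =
      ∑ i ∈ Finset.range n, diagramWeight θ n f * downRate θ n f i := fun f hf => by
    by_cases h : Antitone f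
    · rw [← Finset.mul_sum, sum_downRate hθ n h, (Finset.mem_piAntidiag.1 hf).1]
    · simp [diagramWeight, h]
  rw [Finset.sum_mul, Finset.sum_mul, Finset.sum_congr rfl hup, Finset.sum_congr rfl hdown,
    Finset.sum_comm, Finset.sum_comm (s := (Finset.range n).piAntidiag k)]
  refine Finset.sum_congr rfl fun i hi => ?_
  have hin := Finset.mem_range.1 hi
  rw [← Finset.sum_filter_of_ne (p := fun f : ℕ → ℕ => f i ≠ 0)]
  · symm
    refine Finset.sum_nbij' (fun f => f + Pi.single i 1) (fun f => f - Pi.single i 1) ?_ ?_ ?_ ?_ ?_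
    · intro f hf
      rw [Finset.mem_piAntidiag] at hf
      simp only [Finset.mem_filter, Finset.mem_piAntidiag, Pi.add_apply, Finset.sum_add_distrib]
      refine ⟨⟨?_, fun j hj => ?_⟩, by simp⟩
      · rw [hf.1, Finset.sum_pi_single', if_pos hi]
      · rcases eq_or_ne j i with rfl | hji
        · exact hi
        · exact hf.2 j (by simpa [hji] using hj)
    · intro f hf
      simp only [Finset.mem_filter, Finset.mem_piAntidiag] at hf
      obtain ⟨⟨h₁, h₂⟩, h₃⟩ := hf
      have hle : Pi.single i 1 ≤ f := fun j => by
        rcases eq_or_ne j i with rfl | hji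
        · simpa using Nat.one_le_iff_ne_zero.2 h₃
        · simp [hji]
      rw [Finset.mem_piAntidiag]
      refine ⟨?_, fun j hj => h₂ j fun h0 => hj (by simp [h0])⟩
      have := Finset.sum_add_distrib (s := Finset.range n) (f := f - Pi.single i 1)
        (g := Pi.single i 1)
      simp only [← Pi.add_apply, tsub_add_cancel_of_le hle, h₁] at this
      rw [Finset.sum_pi_single', if_pos hi] at this
      exact (Nat.add_right_cancel this).symm
    · intro f _
      simp
    · intro f hf
      have h₃ := (Finset.mem_filter.1 hf).2
      refine tsub_add_cancel_of_le fun j => ?_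
      rcases eq_or_ne j i with rfl | hji
      · simpa using Nat.one_le_iff_ne_zero.2 h₃
      · simp [hji]
    · intro f hf
      exact diagramWeight_mul_upRate hθ hin fun j hj =>
        Finset.mem_range.1 ((Finset.mem_piAntidiag.1 hf).2 j hj)
  · intro f _ hne h0
    refine hne ?_
    by_cases h : Antitone f
    · rw [downRate_eq_zero_of_row_eq_zero h hin h0, mul_zero]
    · simp [diagramWeight, h]

theorem sum_diagramWeight {θ : ℝ} (hθ : 0 < θ) (n k : ℕ) :
    ∑ f ∈ (Finset.range n).piAntidiag k, diagramWeight θ n f =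
      gammaWeight θ n 0 * (n ^ k / k.factorial) := by
  induction k with
  | zero =>
    have h : Antitone (0 : ℕ → ℕ) := antitone_const
    simp [diagramWeight, h]
  | succ k ih =>
    have h := sum_diagramWeight_succ hθ n k
    have hk : ((k + 1 : ℕ) : ℝ) ≠ 0 := by positivity
    rw [ih] at h
    rw [eq_div_of_mul_eq hk h, Nat.factorial_succ, pow_succ]
    push_cast
    field_simp

theorem prod_Ico_sub_eq_Gamma_div {a b : ℕ} (hab : b ≤ a) {z : ℝ} (hz : 0 < z - a) :
    ∏ j ∈ Finset.Ico b a, (z - j - 1) = Real.Gamma (z - b) / Real.Gamma (z - a) := by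
  induction a, hab using Nat.le_induction with
  | base => simp [(Real.Gamma_pos_of_pos hz).ne']
  | succ a hab ih =>
    push_cast at hz
    have hΓ := Real.Gamma_add_one (s := z - a - 1) (by linarith)
    rw [sub_add_cancel] at hΓ
    rw [Finset.prod_Ico_succ_top hab, ih (by linarith), hΓ]
    have h₀ : z - a - 1 ≠ 0 := by linarith
    push_cast
    rw [show z - (a + 1) = z - a - 1 by ring]
    have := (Real.Gamma_pos_of_pos (s := z - a - 1) (by linarith)).ne'
    field_simp

theorem prod_range_add_eq_Gamma_div {z : ℝ} (hz : 0 < z) (m : ℕ) :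
    ∏ j ∈ Finset.range m, (z + j) = Real.Gamma (z + m) / Real.Gamma z := by
  induction m with
  | zero => simp [(Real.Gamma_pos_of_pos hz).ne']
  | succ m ih =>
    have hΓ := Real.Gamma_add_one (s := z + m) (by positivity)
    rw [Finset.prod_range_succ, ih]
    push_cast
    rw [← add_assoc, hΓ]
    ring

theorem YoungDiagram.rowLen_eq_zero {lam : YoungDiagram} {n i : ℕ} (h : lam.colLen 0 ≤ n)
    (hi : n ≤ i) : lam.rowLen i = 0 := by
  by_contra h0
  have : (i, 0) ∈ lam := mem_iff_lt_rowLen.2 (Nat.pos_of_ne_zero h0)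
  have := mem_iff_lt_colLen.1 this
  omega

theorem YoungDiagram.colLen_eq {lam : YoungDiagram} {m j : ℕ} (h : j < lam.rowLen m)
    (h' : lam.rowLen (m + 1) ≤ j) : lam.colLen j = m + 1 := by
  have h₁ := mem_iff_lt_colLen.1 (mem_iff_lt_rowLen.2 h)
  have h₂ : ¬ m + 1 < lam.colLen j := fun hlt => by
    have := mem_iff_lt_rowLen.1 (mem_iff_lt_colLen.2 hlt)
    omega
  omega

theorem YoungDiagram.prod_row_eq_Gamma {θ s : ℝ} (hθ : 0 < θ) (hs : 0 < s) (lam : YoungDiagram)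
    {i m : ℕ} (him : i ≤ m) :
    ∏ j ∈ Finset.Ico (lam.rowLen m) (lam.rowLen i),
        ((lam.rowLen i - j - 1 : ℝ) + θ * (lam.colLen j - i - 1) + s) =
      ∏ k ∈ Finset.Ico i m,
        Real.Gamma (lam.rowLen i - lam.rowLen (k + 1) + θ * (k - i) + s) /
          Real.Gamma (lam.rowLen i - lam.rowLen k + θ * (k - i) + s) := by
  induction m, him using Nat.le_induction with
  | base => simp
  | succ m him ih =>
    have h₁ := lam.rowLen_anti m (m + 1) m.le_succ
    have h₂ := lam.rowLen_anti i m him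
    rw [← Finset.prod_Ico_consecutive _ h₁ h₂, ih, Finset.prod_Ico_succ_top him, mul_comm]
    congr 1
    have h₃ : (lam.rowLen m : ℝ) ≤ lam.rowLen i := by exact_mod_cast h₂
    have h₄ : 0 ≤ θ * ((m : ℝ) - i) := mul_nonneg hθ.le (sub_nonneg.2 (by exact_mod_cast him))
    have key := prod_Ico_sub_eq_Gamma_div (z := lam.rowLen i + θ * (m - i) + s) h₁ (by linarith)
    rw [show (lam.rowLen i - lam.rowLen (m + 1) + θ * (m - i) + s : ℝ) =
      lam.rowLen i + θ * (m - i) + s - lam.rowLen (m + 1) by ring,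
      show (lam.rowLen i - lam.rowLen m + θ * (m - i) + s : ℝ) =
      lam.rowLen i + θ * (m - i) + s - lam.rowLen m by ring, ← key]
    refine Finset.prod_congr rfl fun j hj => ?_
    rw [Finset.mem_Ico] at hj
    rw [YoungDiagram.colLen_eq hj.2 hj.1]
    push_cast
    ring

theorem YoungDiagram.prod_row_eq_Gamma_mul {θ s : ℝ} (hθ : 0 < θ) (hs : 0 < s)
    {lam : YoungDiagram} {n i : ℕ} (h : lam.colLen 0 ≤ n) (hi : i < n) :
    ∏ j ∈ Finset.range (lam.rowLen i),
        ((lam.rowLen i - j - 1 : ℝ) + θ * (lam.colLen j - i - 1) + s) =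
      Real.Gamma (shiftedRow θ n lam.rowLen i + s) / Real.Gamma s *
        ∏ k ∈ Finset.Ico (i + 1) n,
          Real.Gamma (shiftedRow θ n lam.rowLen i - shiftedRow θ n lam.rowLen k - θ + s) /
            Real.Gamma (shiftedRow θ n lam.rowLen i - shiftedRow θ n lam.rowLen k + s) := by
  have h0 := YoungDiagram.rowLen_eq_zero h le_rfl
  have key := lam.prod_row_eq_Gamma hθ hs hi.le
  rw [h0, ← Finset.range_eq_Ico] at key
  rw [key, Finset.prod_div_distrib, Finset.prod_div_distrib]
  obtain ⟨m, rfl⟩ : ∃ m, n = m + 1 := ⟨n - 1, by omega⟩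
  rw [Finset.prod_Ico_succ_top (by omega), Finset.prod_eq_prod_Ico_succ_bot hi, h0]
  have e : ∀ a b c d : ℝ, a * b / (c * d) = b / c * (a / d) := fun a b c d => by
    rw [mul_comm a b, mul_div_mul_comm]
  rw [e]
  congr 2
  · congr 1
    simp only [shiftedRow]
    push_cast
    ring
  · congr 1
    ring
  · rw [← Finset.prod_Ico_add' _ i m 1]
    refine Finset.prod_congr rfl fun k _ => congrArg _ ?_
    simp only [shiftedRow]
    push_cast
    ring
  · refine Finset.prod_congr rfl fun k _ => congrArg _ ?_
    simp only [shiftedRow]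
    ring

theorem YoungDiagram.prod_cells {M : Type*} [CommMonoid M] {lam : YoungDiagram} {n : ℕ}
    (h : lam.colLen 0 ≤ n) (F : ℕ × ℕ → M) :
    ∏ c ∈ lam.cells, F c =
      ∏ i ∈ Finset.range n, ∏ j ∈ Finset.range (lam.rowLen i), F (i, j) := by
  refine Finset.prod_finset_product _ _ _ fun c => ?_
  rw [YoungDiagram.mem_cells, Finset.mem_range, Finset.mem_range]
  refine ⟨fun hc => ⟨?_, mem_iff_lt_rowLen.1 hc⟩, fun hc => mem_iff_lt_rowLen.2 hc.2⟩
  by_contra hn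
  have := mem_iff_lt_rowLen.1 hc
  rw [YoungDiagram.rowLen_eq_zero h (not_lt.1 hn)] at this
  omega

/-- The product over boxes of `(θn + a' - θl') / ((a + θl + θ)(a + θl + 1))`. -/
noncomputable def boxProduct (θ : ℝ) (n : ℕ) (lam : YoungDiagram) : ℝ :=
  ∏ c ∈ lam.cells,
    (θ * n + (c.2 : ℝ) - θ * (c.1 : ℝ)) /
      ((((lam.rowLen c.1 : ℝ) - (c.2 : ℝ) - 1)
          + θ * ((lam.colLen c.2 : ℝ) - (c.1 : ℝ) - 1) + θ) *
       (((lam.rowLen c.1 : ℝ) - (c.2 : ℝ) - 1)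
          + θ * ((lam.colLen c.2 : ℝ) - (c.1 : ℝ) - 1) + 1))

theorem boxProduct_eq {θ : ℝ} (hθ : 0 < θ) {n : ℕ} {lam : YoungDiagram} (h : lam.colLen 0 ≤ n) :
    boxProduct θ n lam =
      (∏ i ∈ Finset.range n, (Real.Gamma θ / Real.Gamma (θ * (n - i)))) *
        gammaWeight θ n lam.rowLen := by
  unfold boxProduct gammaWeight
  rw [YoungDiagram.prod_cells h, ← Finset.prod_mul_distrib, ← Finset.prod_mul_distrib]
  refine Finset.prod_congr rfl fun i hi => ?_
  have hin := Finset.mem_range.1 hi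
  have hni : (i : ℝ) + 1 ≤ n := by exact_mod_cast hin
  have hpos : 0 < θ * (n - i) := mul_pos hθ (by linarith)
  have hnum : ∏ j ∈ Finset.range (lam.rowLen i), (θ * (n : ℝ) + (j : ℝ) - θ * (i : ℝ)) =
      Real.Gamma (shiftedRow θ n lam.rowLen i + θ) / Real.Gamma (θ * (n - i)) := by
    rw [show shiftedRow θ n lam.rowLen i + θ = θ * (n - i) + lam.rowLen i by
      simp only [shiftedRow]; ring, ← prod_range_add_eq_Gamma_div hpos]
    exact Finset.prod_congr rfl fun j _ => by ring
  have hfil : (Finset.range n).filter (i < ·) = Finset.Ico (i + 1) n := by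
    ext k; simp; omega
  rw [Finset.prod_div_distrib, Finset.prod_mul_distrib,
    YoungDiagram.prod_row_eq_Gamma_mul hθ hθ h hin,
    YoungDiagram.prod_row_eq_Gamma_mul hθ one_pos h hin, ← Finset.prod_filter, hfil, hnum,
    Real.Gamma_one]
  have hrow : 0 < shiftedRow θ n lam.rowLen i + θ := by
    have : shiftedRow θ n lam.rowLen i + θ = θ * (n - i) + lam.rowLen i := by
      simp only [shiftedRow]; ring
    rw [this]; positivity
  have hrow₁ : 0 < shiftedRow θ n lam.rowLen i + 1 := by
    have : 0 ≤ θ * ((n : ℝ) - 1 - i) := mul_nonneg hθ.le (by linarith)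
    unfold shiftedRow
    positivity
  have hint : ∏ k ∈ Finset.Ico (i + 1) n,
      gammaInteraction θ (shiftedRow θ n lam.rowLen i - shiftedRow θ n lam.rowLen k) =
      ((∏ k ∈ Finset.Ico (i + 1) n,
          Real.Gamma (shiftedRow θ n lam.rowLen i - shiftedRow θ n lam.rowLen k - θ + θ) /
            Real.Gamma (shiftedRow θ n lam.rowLen i - shiftedRow θ n lam.rowLen k + θ)) *
        ∏ k ∈ Finset.Ico (i + 1) n,
          Real.Gamma (shiftedRow θ n lam.rowLen i - shiftedRow θ n lam.rowLen k - θ + 1) /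
            Real.Gamma (shiftedRow θ n lam.rowLen i - shiftedRow θ n lam.rowLen k + 1))⁻¹ := by
    rw [← Finset.prod_mul_distrib, ← Finset.prod_inv_distrib]
    refine Finset.prod_congr rfl fun k _ => ?_
    rw [div_mul_div_comm, inv_div, sub_add_cancel, gammaInteraction]
    congr 3
    ring
  have g₁ := (Real.Gamma_pos_of_pos hrow).ne'
  have g₂ := (Real.Gamma_pos_of_pos hrow₁).ne'
  have g₃ := (Real.Gamma_pos_of_pos hθ).ne'
  have g₄ := (Real.Gamma_pos_of_pos hpos).ne'
  rw [hint, mul_inv]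
  generalize (∏ k ∈ Finset.Ico (i + 1) n,
    Real.Gamma (shiftedRow θ n lam.rowLen i - shiftedRow θ n lam.rowLen k - θ + θ) /
      Real.Gamma (shiftedRow θ n lam.rowLen i - shiftedRow θ n lam.rowLen k + θ)) = A
  generalize (∏ k ∈ Finset.Ico (i + 1) n,
    Real.Gamma (shiftedRow θ n lam.rowLen i - shiftedRow θ n lam.rowLen k - θ + 1) /
      Real.Gamma (shiftedRow θ n lam.rowLen i - shiftedRow θ n lam.rowLen k + 1)) = B
  simp only [div_eq_mul_inv, mul_inv, inv_inv, inv_one, mul_one]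
  field_simp

theorem boxProduct_nonneg {θ : ℝ} (hθ : 0 < θ) {n : ℕ} {lam : YoungDiagram}
    (h : lam.colLen 0 ≤ n) : 0 ≤ boxProduct θ n lam := by
  refine Finset.prod_nonneg fun ⟨i, j⟩ hc => ?_
  rw [YoungDiagram.mem_cells] at hc
  have h₁ := YoungDiagram.mem_iff_lt_rowLen.1 hc
  have h₂ := YoungDiagram.mem_iff_lt_colLen.1 hc
  have h₃ : i + 1 ≤ n := (Nat.succ_le_of_lt h₂).trans ((lam.colLen_anti 0 j (Nat.zero_le j)).trans h)
  have h₁' : (j : ℝ) + 1 ≤ lam.rowLen i := by exact_mod_cast h₁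
  have h₂' : (i : ℝ) + 1 ≤ lam.colLen j := by exact_mod_cast h₂
  have h₃' : (i : ℝ) + 1 ≤ n := by exact_mod_cast h₃
  have h₄ : 0 ≤ θ * ((lam.colLen j : ℝ) - i - 1) := mul_nonneg hθ.le (by linarith)
  have h₅ : 0 ≤ θ * ((n : ℝ) - i) := mul_nonneg hθ.le (by linarith)
  have h₆ : (0 : ℝ) ≤ j := j.cast_nonneg
  dsimp only
  refine div_nonneg (by linarith) (mul_nonneg ?_ ?_) <;> linarith

theorem YoungDiagram.rowLen_injective : Function.Injective YoungDiagram.rowLen := by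
  intro lam mu h
  ext ⟨i, j⟩
  rw [mem_cells, mem_cells, mem_iff_lt_rowLen, mem_iff_lt_rowLen, h]

theorem YoungDiagram.exists_rowLen_eq {f : ℕ → ℕ} (hf : Antitone f) {n : ℕ}
    (hn : ∀ i, f i ≠ 0 → i < n) : ∃ lam : YoungDiagram, lam.rowLen = f ∧ lam.colLen 0 ≤ n := by
  let lam : YoungDiagram :=
    { cells := (Finset.range n ×ˢ Finset.range (f 0)).filter fun c => c.2 < f c.1
      isLowerSet := by
        rintro ⟨i, j⟩ ⟨i', j'⟩ ⟨hi, hj⟩ hc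
        simp only [Finset.coe_filter, Finset.mem_product, Finset.mem_range,
          Set.mem_ofPred_eq] at hc ⊢
        simp only at hi hj
        have := hf hi
        omega }
  have hmem : ∀ i j, (i, j) ∈ lam ↔ j < f i := fun i j => by
    rw [← YoungDiagram.mem_cells]
    simp only [lam, Finset.mem_filter, Finset.mem_product, Finset.mem_range]
    have h₁ := hf (Nat.zero_le i)
    have h₂ := hn i
    omega
  have hrow : lam.rowLen = f := funext fun i =>
    eq_of_forall_lt_iff fun j => by rw [← mem_iff_lt_rowLen, hmem]
  refine ⟨lam, hrow, ?_⟩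
  by_contra hlt
  have h₁ := mem_iff_lt_colLen.2 (not_le.1 hlt)
  rw [hmem] at h₁
  exact lt_irrefl n (hn n (by omega))

theorem YoungDiagram.card_cells {lam : YoungDiagram} {n : ℕ} (h : lam.colLen 0 ≤ n) :
    lam.cells.card = ∑ i ∈ Finset.range n, lam.rowLen i := by
  have := YoungDiagram.prod_cells h (fun _ => Multiplicative.ofAdd 1)
  apply_fun Multiplicative.toAdd at this
  simpa using this

open Classical in
theorem hasSum_boxProduct_of_card {θ : ℝ} (hθ : 0 < θ) (n k : ℕ) :
    HasSum (fun lam : {lam : {lam : YoungDiagram // lam.colLen 0 ≤ n} // lam.1.cells.card = k} =>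
      boxProduct θ n lam.1.1) (n ^ k / k.factorial) := by
  set K := ∏ i ∈ Finset.range n, (Real.Gamma θ / Real.Gamma (θ * (n - i))) with hK
  have hK₁ : K * gammaWeight θ n 0 = 1 := by
    have hcol : (⊥ : YoungDiagram).colLen 0 = 0 := by
      by_contra h0
      exact YoungDiagram.notMem_bot _ (YoungDiagram.mem_iff_lt_colLen.2 (Nat.pos_of_ne_zero h0))
    have hrow : (⊥ : YoungDiagram).rowLen = 0 := by
      funext i
      exact YoungDiagram.rowLen_eq_zero hcol.le (Nat.zero_le i)
    have := boxProduct_eq hθ (n := n) (hcol.trans_le (Nat.zero_le n))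
    rw [hrow] at this
    rw [hK, ← this]
    simp [boxProduct]
  let F : (ℕ → ℕ) → ℝ := fun f =>
    if f ∈ (Finset.range n).piAntidiag k then K * diagramWeight θ n f else 0
  have hF : HasSum F (n ^ k / k.factorial) := by
    have := hasSum_sum_of_ne_finset_zero (f := F) (L := .unconditional _)
      (s := (Finset.range n).piAntidiag k)
      (fun f hf => if_neg hf)
    rwa [Finset.sum_congr rfl fun f hf => if_pos hf, ← Finset.mul_sum, sum_diagramWeight hθ,
      ← mul_assoc, hK₁, one_mul] at this
  have hinj : Function.Injective (fun lam : {lam : {lam : YoungDiagram // lam.colLen 0 ≤ n} //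
      lam.1.cells.card = k} => lam.1.1.rowLen) := fun lam mu h =>
    Subtype.ext (Subtype.ext (YoungDiagram.rowLen_injective h))
  have hcomp : ∀ lam : {lam : {lam : YoungDiagram // lam.colLen 0 ≤ n} // lam.1.cells.card = k},
      boxProduct θ n lam.1.1 = F lam.1.1.rowLen := by
    rintro ⟨⟨lam, h⟩, hc⟩
    have hanti : Antitone lam.rowLen := fun i j hij => lam.rowLen_anti i j hij
    have hmem : lam.rowLen ∈ (Finset.range n).piAntidiag k := by
      rw [Finset.mem_piAntidiag, ← YoungDiagram.card_cells h]
      refine ⟨hc, fun i hi => Finset.mem_range.2 ?_⟩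
      by_contra hn
      exact hi (YoungDiagram.rowLen_eq_zero h (not_lt.1 hn))
    simp only [F, if_pos hmem, diagramWeight, if_pos hanti, boxProduct_eq hθ h, hK]
  simp only [hcomp]
  refine (hinj.hasSum_iff (f := F) fun f hf => ?_).2 hF
  by_contra hne
  simp only [F, ite_eq_right_iff, not_forall, diagramWeight] at hne
  obtain ⟨hmem, hne⟩ := hne
  have hanti : Antitone f := by
    by_contra h
    simp [h] at hne
  rw [Finset.mem_piAntidiag] at hmem
  obtain ⟨lam, hrow, hcol⟩ := YoungDiagram.exists_rowLen_eq hanti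
    fun i hi => Finset.mem_range.1 (hmem.2 i hi)
  exact hf ⟨⟨⟨lam, hcol⟩, by rw [YoungDiagram.card_cells hcol, hrow, hmem.1]⟩, hrow⟩


/-- Normalization identity implied by Theorem 1.1: for `θ > 0`, `n ≥ 1` and `r > 0`,
`∑_λ r^{|λ|} ∏_{□ ∈ λ} (θn + a'_□ − θ l'_□)/((a_□ + θ l_□ + θ)(a_□ + θ l_□ + 1)) = e^{rn}`,
the sum being over all Young diagrams `λ` with at most `n` nonzero rows. Boxes `c = (i, j)`
are 0-indexed, so `a'_□ = c.2`, `l'_□ = c.1`, `a_□ = rowLen c.1 − c.2 − 1`,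
`l_□ = colLen c.2 − c.1 − 1`. -/
theorem stmt14 (θ : ℝ) (hθ : 0 < θ) (n : ℕ) (hn : 1 ≤ n) (r : ℝ) (hr : 0 < r) :
    HasSum (fun lam : {lam : YoungDiagram // lam.colLen 0 ≤ n} =>
      r ^ lam.1.cells.card *
        ∏ c ∈ lam.1.cells,
          (θ * n + (c.2 : ℝ) - θ * (c.1 : ℝ)) /
            ((((lam.1.rowLen c.1 : ℝ) - (c.2 : ℝ) - 1)
                + θ * ((lam.1.colLen c.2 : ℝ) - (c.1 : ℝ) - 1) + θ) *
             (((lam.1.rowLen c.1 : ℝ) - (c.2 : ℝ) - 1)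
                + θ * ((lam.1.colLen c.2 : ℝ) - (c.1 : ℝ) - 1) + 1)))
      (Real.exp (r * n)) := by
  change HasSum (fun lam : {lam : YoungDiagram // lam.colLen 0 ≤ n} =>
    r ^ lam.1.cells.card * boxProduct θ n lam.1) (Real.exp (r * n))
  rw [← (Equiv.sigmaFiberEquiv fun lam : {lam : YoungDiagram // lam.colLen 0 ≤ n} =>
    lam.1.cells.card).hasSum_iff]
  have hfib : ∀ k, HasSum (fun lam : {lam : {lam : YoungDiagram // lam.colLen 0 ≤ n} //
      lam.1.cells.card = k} => r ^ lam.1.1.cells.card * boxProduct θ n lam.1.1)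
      ((r * n) ^ k / k.factorial) := fun k => by
    have h := (hasSum_boxProduct_of_card hθ n k).mul_left (r ^ k)
    rw [← mul_div_assoc, ← mul_pow] at h
    exact h.congr_fun fun lam => by rw [lam.2]
  have hexp : HasSum (fun k : ℕ => (r * n) ^ k / k.factorial) (Real.exp (r * n)) := by
    rw [Real.exp_eq_exp_ℝ]
    exact NormedSpace.expSeries_div_hasSum_exp (r * n : ℝ)
  refine HasSum.sigma_of_hasSum hexp hfib ((summable_sigma_of_nonneg ?_).2 ⟨?_, ?_⟩)
  · rintro ⟨k, lam⟩
    exact mul_nonneg (pow_nonneg hr.le _) (boxProduct_nonneg hθ lam.1.2)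
  · exact fun k => (hfib k).summable
  · exact hexp.summable.congr fun k => (hfib k).tsum_eq.symm
end
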